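/- The following formulas define a structure of a left R(α)-module on Pol(α) = ⊕_{ν∈I^α} ℍ[x_1,…,x_m] (one polynomial-ring component for each ν ∈ I^α), and this module is faithful: e(ν) acts as the projection onto the ν-component; x_k acts on the ν-component as multiplication by x_k; and r_l maps the ν-component to the s_lν-component by f ↦ (∏_{a∈Λ_{ν_l,ν_{l+1}}}(x_l − x_{l+1} + ℏ_a))·(s_l f) if s_lν ≠ ν, and maps the ν-component to itself by f ↦ (∏_{a∈Λ_{ν_l,ν_l}}(x_l − x_{l+1} + ℏ_a))·(∂_l f) if s_lν = ν. -/

import Mathlib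

open MvPolynomial

/-- The base ring `ℍ = ℂ[ℏ_a : a ∈ ⊔_{i,j} Λ_{i,j}]`. -/
abbrev HRing (I : Type) (Λ : I → I → Type) : Type :=
  MvPolynomial ((i : I) × (j : I) × Λ i j) ℂ

/-- The generator `ℏ_a` for `a ∈ Λ_{i,j}`. -/
noncomputable def hbar (I : Type) (Λ : I → I → Type) (i j : I) (a : Λ i j) : HRing I Λ :=
  X ⟨i, j, a⟩

/-- `I^α`: the set of all sequences obtained by permuting the fixed sequence `ν₀`
(equivalently, all sequences `ν` with `α_{ν_1} + ⋯ + α_{ν_m} = α`). -/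
noncomputable def Ialpha (I : Type) [DecidableEq I] (m : ℕ) (ν₀ : Fin m → I) :
    Finset (Fin m → I) :=
  Finset.image (fun σ : Equiv.Perm (Fin m) => ν₀ ∘ σ) Finset.univ

/-- Elements of `I^α`. -/
abbrev Idx (I : Type) [DecidableEq I] (m : ℕ) (ν₀ : Fin m → I) : Type :=
  {ν : Fin m → I // ν ∈ Ialpha I m ν₀}

/-- Generators of the Khovanov-Lauda-Rouquier algebra: the idempotents `e(ν)`,
the polynomial generators `x_k` and the intertwiners `r_t`. -/
inductive KLRGen (I : Type) [DecidableEq I] (m : ℕ) (ν₀ : Fin m → I) : Type where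
  | e : Idx I m ν₀ → KLRGen I m ν₀
  | x : Fin m → KLRGen I m ν₀
  | r : {t : ℕ // t + 1 < m} → KLRGen I m ν₀

/-- The free `ℍ`-algebra on the generators. -/
abbrev KLRFree (I : Type) [DecidableEq I] (Λ : I → I → Type) (m : ℕ) (ν₀ : Fin m → I) :
    Type :=
  FreeAlgebra (HRing I Λ) (KLRGen I m ν₀)

section
variable (I : Type) [DecidableEq I] (Λ : I → I → Type) [∀ i j, Fintype (Λ i j)]
  (m : ℕ) (ν₀ : Fin m → I)

noncomputable def ge (ν : Idx I m ν₀) : KLRFree I Λ m ν₀ :=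
  FreeAlgebra.ι _ (KLRGen.e ν)

noncomputable def gx (k : Fin m) : KLRFree I Λ m ν₀ :=
  FreeAlgebra.ι _ (KLRGen.x k)

noncomputable def gr (t : {t : ℕ // t + 1 < m}) : KLRFree I Λ m ν₀ :=
  FreeAlgebra.ι _ (KLRGen.r t)

/-- `t` as an element of `Fin m`. -/
def fa (t : {t : ℕ // t + 1 < m}) : Fin m := ⟨t.1, Nat.lt_of_succ_lt t.2⟩

/-- `t+1` as an element of `Fin m`. -/
def fb (t : {t : ℕ // t + 1 < m}) : Fin m := ⟨t.1 + 1, t.2⟩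

/-- The action of the transposition `s_t` on `I^α`. -/
noncomputable def sAct (t : {t : ℕ // t + 1 < m}) (ν : Idx I m ν₀) : Idx I m ν₀ :=
  ⟨ν.1 ∘ Equiv.swap (fa m t) (fb m t), by
    obtain ⟨σ, -, hσ⟩ := Finset.mem_image.1 ν.2
    refine Finset.mem_image.2 ⟨σ * Equiv.swap (fa m t) (fb m t), Finset.mem_univ _, ?_⟩
    rw [← hσ]
    ext k
    simp [Equiv.Perm.coe_mul, Function.comp]⟩

/-- The commutative polynomial ring in three variables over `ℍ`, used to write down the
coefficient polynomials of the defining relations. -/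
abbrev CPol : Type := MvPolynomial (Fin 3) (HRing I Λ)

/-- `P_i(u,v) = ∏_{a ∈ Λ_{i,i}} (u − v + ℏ_a)`. -/
noncomputable def Pc (i : I) (u v : CPol I Λ) : CPol I Λ :=
  ∏ a : Λ i i, (u - v + C (hbar I Λ i i a))

/-- `Q_{i,j}(u,v)`: zero if `i = j`, and
`∏_{a ∈ Λ_{i,j}} (v − u + ℏ_a) · ∏_{a ∈ Λ_{j,i}} (u − v + ℏ_a)` otherwise. -/
noncomputable def Qc (i j : I) (u v : CPol I Λ) : CPol I Λ :=
  if i = j then 0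
  else (∏ a : Λ i j, (v - u + C (hbar I Λ i j a))) * (∏ a : Λ j i, (u - v + C (hbar I Λ j i a)))

/-- Noncommutative evaluation (in a fixed monomial order) of a commutative polynomial
at the elements `g 0`, `g 1`, `g 2` of the free algebra. -/
noncomputable def ncEval (g : Fin 3 → KLRFree I Λ m ν₀) (p : CPol I Λ) :
    KLRFree I Λ m ν₀ :=
  ∑ s ∈ p.support,
    algebraMap (HRing I Λ) (KLRFree I Λ m ν₀) (MvPolynomial.coeff s p) *
      ((g 0) ^ (s 0) * ((g 1) ^ (s 1) * (g 2) ^ (s 2)))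

/-- Evaluation at `x_t`, `x_{t+1}` (third variable unused). -/
noncomputable def gv (t : {t : ℕ // t + 1 < m}) : Fin 3 → KLRFree I Λ m ν₀ :=
  ![gx I Λ m ν₀ (fa m t), gx I Λ m ν₀ (fb m t), 1]

/-- Evaluation at `x_t`, `x_{t+1}`, `x_{t+2}`. -/
noncomputable def gv3 (t : ℕ) (h2 : t + 2 < m) : Fin 3 → KLRFree I Λ m ν₀ :=
  ![gx I Λ m ν₀ ⟨t, by omega⟩, gx I Λ m ν₀ ⟨t + 1, by omega⟩, gx I Λ m ν₀ ⟨t + 2, h2⟩]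

end
/-- The defining relations of the Khovanov-Lauda-Rouquier algebra `R(α)` associated with
the data `(Λ_{i,j})`, with `P_i`, `Q_{i,j}` the product-form polynomials.  Divided
differences (`∂_t P`, `Q̄_{i,j}`, `P̄'`, `P̄''`) are encoded by their defining identities
in the commutative coefficient ring. -/
inductive KLRRel (I : Type) [DecidableEq I] (Λ : I → I → Type) [∀ i j, Fintype (Λ i j)]
    (m : ℕ) (ν₀ : Fin m → I) : KLRFree I Λ m ν₀ → KLRFree I Λ m ν₀ → Prop where
  | e_orth (ν ν' : Idx I m ν₀) (h : ν ≠ ν') :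
      KLRRel I Λ m ν₀ (ge I Λ m ν₀ ν * ge I Λ m ν₀ ν') 0
  | e_idem (ν : Idx I m ν₀) :
      KLRRel I Λ m ν₀ (ge I Λ m ν₀ ν * ge I Λ m ν₀ ν) (ge I Λ m ν₀ ν)
  | e_sum :
      KLRRel I Λ m ν₀ (∑ ν ∈ (Ialpha I m ν₀).attach, ge I Λ m ν₀ ν) 1
  | x_e (k : Fin m) (ν : Idx I m ν₀) :
      KLRRel I Λ m ν₀ (gx I Λ m ν₀ k * ge I Λ m ν₀ ν) (ge I Λ m ν₀ ν * gx I Λ m ν₀ k)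
  | x_x (k l : Fin m) :
      KLRRel I Λ m ν₀ (gx I Λ m ν₀ k * gx I Λ m ν₀ l) (gx I Λ m ν₀ l * gx I Λ m ν₀ k)
  | r_e (t : {t : ℕ // t + 1 < m}) (ν : Idx I m ν₀) :
      KLRRel I Λ m ν₀ (gr I Λ m ν₀ t * ge I Λ m ν₀ ν)
        (ge I Λ m ν₀ (sAct I m ν₀ t ν) * gr I Λ m ν₀ t)
  | r_r_far (t s : {t : ℕ // t + 1 < m}) (h : t.1 + 1 < s.1 ∨ s.1 + 1 < t.1) :
      KLRRel I Λ m ν₀ (gr I Λ m ν₀ t * gr I Λ m ν₀ s) (gr I Λ m ν₀ s * gr I Λ m ν₀ t)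
  | rr_eq (t : {t : ℕ // t + 1 < m}) (ν : Idx I m ν₀)
      (h : ν.1 (fa m t) = ν.1 (fb m t)) (g : CPol I Λ)
      (hg : (X 0 - X 1) * g =
        Pc I Λ (ν.1 (fa m t)) (X 1) (X 0) - Pc I Λ (ν.1 (fa m t)) (X 0) (X 1)) :
      KLRRel I Λ m ν₀ (gr I Λ m ν₀ t * gr I Λ m ν₀ t * ge I Λ m ν₀ ν)
        (ncEval I Λ m ν₀ (gv I Λ m ν₀ t) g * (gr I Λ m ν₀ t * ge I Λ m ν₀ ν))
  | rr_ne (t : {t : ℕ // t + 1 < m}) (ν : Idx I m ν₀)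
      (h : ν.1 (fa m t) ≠ ν.1 (fb m t)) :
      KLRRel I Λ m ν₀ (gr I Λ m ν₀ t * gr I Λ m ν₀ t * ge I Λ m ν₀ ν)
        (ncEval I Λ m ν₀ (gv I Λ m ν₀ t)
            (Qc I Λ (ν.1 (fa m t)) (ν.1 (fb m t)) (X 0) (X 1)) * ge I Λ m ν₀ ν)
  | r_x_far (t : {t : ℕ // t + 1 < m}) (k : Fin m) (hk1 : k ≠ fa m t) (hk2 : k ≠ fb m t)
      (ν : Idx I m ν₀) :
      KLRRel I Λ m ν₀ (gr I Λ m ν₀ t * gx I Λ m ν₀ k * ge I Λ m ν₀ ν)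
        (gx I Λ m ν₀ k * (gr I Λ m ν₀ t * ge I Λ m ν₀ ν))
  | r_x_t_ne (t : {t : ℕ // t + 1 < m}) (ν : Idx I m ν₀)
      (h : ν.1 (fa m t) ≠ ν.1 (fb m t)) :
      KLRRel I Λ m ν₀ (gr I Λ m ν₀ t * gx I Λ m ν₀ (fa m t) * ge I Λ m ν₀ ν)
        (gx I Λ m ν₀ (fb m t) * (gr I Λ m ν₀ t * ge I Λ m ν₀ ν))
  | r_x_t1_ne (t : {t : ℕ // t + 1 < m}) (ν : Idx I m ν₀)
      (h : ν.1 (fa m t) ≠ ν.1 (fb m t)) :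
      KLRRel I Λ m ν₀ (gr I Λ m ν₀ t * gx I Λ m ν₀ (fb m t) * ge I Λ m ν₀ ν)
        (gx I Λ m ν₀ (fa m t) * (gr I Λ m ν₀ t * ge I Λ m ν₀ ν))
  | r_x_t_eq (t : {t : ℕ // t + 1 < m}) (ν : Idx I m ν₀)
      (h : ν.1 (fa m t) = ν.1 (fb m t)) :
      KLRRel I Λ m ν₀ (gr I Λ m ν₀ t * gx I Λ m ν₀ (fa m t) * ge I Λ m ν₀ ν)
        (gx I Λ m ν₀ (fb m t) * (gr I Λ m ν₀ t * ge I Λ m ν₀ ν)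
          - ncEval I Λ m ν₀ (gv I Λ m ν₀ t) (Pc I Λ (ν.1 (fa m t)) (X 0) (X 1)) *
              ge I Λ m ν₀ ν)
  | r_x_t1_eq (t : {t : ℕ // t + 1 < m}) (ν : Idx I m ν₀)
      (h : ν.1 (fa m t) = ν.1 (fb m t)) :
      KLRRel I Λ m ν₀ (gr I Λ m ν₀ t * gx I Λ m ν₀ (fb m t) * ge I Λ m ν₀ ν)
        (gx I Λ m ν₀ (fa m t) * (gr I Λ m ν₀ t * ge I Λ m ν₀ ν)
          + ncEval I Λ m ν₀ (gv I Λ m ν₀ t) (Pc I Λ (ν.1 (fa m t)) (X 0) (X 1)) *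
              ge I Λ m ν₀ ν)
  | braid_far (t : ℕ) (h2 : t + 2 < m) (ν : Idx I m ν₀)
      (h : ν.1 ⟨t, by omega⟩ ≠ ν.1 ⟨t + 2, h2⟩) :
      KLRRel I Λ m ν₀
        (gr I Λ m ν₀ ⟨t + 1, by omega⟩ * gr I Λ m ν₀ ⟨t, by omega⟩ *
            gr I Λ m ν₀ ⟨t + 1, by omega⟩ * ge I Λ m ν₀ ν)
        (gr I Λ m ν₀ ⟨t, by omega⟩ * gr I Λ m ν₀ ⟨t + 1, by omega⟩ *
            gr I Λ m ν₀ ⟨t, by omega⟩ * ge I Λ m ν₀ ν)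
  | braid_Q (t : ℕ) (h2 : t + 2 < m) (ν : Idx I m ν₀)
      (hac : ν.1 ⟨t, by omega⟩ = ν.1 ⟨t + 2, h2⟩)
      (hab : ν.1 ⟨t, by omega⟩ ≠ ν.1 ⟨t + 1, by omega⟩)
      (q : CPol I Λ)
      (hq : (X 0 - X 2) * q =
        Qc I Λ (ν.1 ⟨t, by omega⟩) (ν.1 ⟨t + 1, by omega⟩) (X 0) (X 1)
          - Qc I Λ (ν.1 ⟨t, by omega⟩) (ν.1 ⟨t + 1, by omega⟩) (X 2) (X 1)) :
      KLRRel I Λ m ν₀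
        (gr I Λ m ν₀ ⟨t + 1, by omega⟩ * gr I Λ m ν₀ ⟨t, by omega⟩ *
            gr I Λ m ν₀ ⟨t + 1, by omega⟩ * ge I Λ m ν₀ ν)
        (gr I Λ m ν₀ ⟨t, by omega⟩ * gr I Λ m ν₀ ⟨t + 1, by omega⟩ *
            gr I Λ m ν₀ ⟨t, by omega⟩ * ge I Λ m ν₀ ν
          + ncEval I Λ m ν₀ (gv3 I Λ m ν₀ t h2)
              (Pc I Λ (ν.1 ⟨t, by omega⟩) (X 0) (X 2) * q) * ge I Λ m ν₀ ν)
  | braid_P (t : ℕ) (h2 : t + 2 < m) (ν : Idx I m ν₀)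
      (hab : ν.1 ⟨t, by omega⟩ = ν.1 ⟨t + 1, by omega⟩)
      (hbc : ν.1 ⟨t + 1, by omega⟩ = ν.1 ⟨t + 2, h2⟩)
      (p p' : CPol I Λ)
      (hp : ((X 0 - X 1) * ((X 0 - X 2) * (X 1 - X 2))) * p =
        Pc I Λ (ν.1 ⟨t, by omega⟩) (X 1) (X 0) * Pc I Λ (ν.1 ⟨t, by omega⟩) (X 0) (X 2) *
            (X 1 - X 2)
          + Pc I Λ (ν.1 ⟨t, by omega⟩) (X 0) (X 2) * Pc I Λ (ν.1 ⟨t, by omega⟩) (X 1) (X 2) *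
            (X 0 - X 1)
          - Pc I Λ (ν.1 ⟨t, by omega⟩) (X 0) (X 1) * Pc I Λ (ν.1 ⟨t, by omega⟩) (X 1) (X 2) *
            (X 0 - X 2))
      (hp' : ((X 0 - X 1) * ((X 0 - X 2) * (X 1 - X 2))) * p' =
        -(Pc I Λ (ν.1 ⟨t, by omega⟩) (X 0) (X 1) * Pc I Λ (ν.1 ⟨t, by omega⟩) (X 0) (X 2) *
            (X 1 - X 2))
          - Pc I Λ (ν.1 ⟨t, by omega⟩) (X 0) (X 2) * Pc I Λ (ν.1 ⟨t, by omega⟩) (X 2) (X 1) *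
            (X 0 - X 1)
          + Pc I Λ (ν.1 ⟨t, by omega⟩) (X 0) (X 1) * Pc I Λ (ν.1 ⟨t, by omega⟩) (X 1) (X 2) *
            (X 0 - X 2)) :
      KLRRel I Λ m ν₀
        (gr I Λ m ν₀ ⟨t + 1, by omega⟩ * gr I Λ m ν₀ ⟨t, by omega⟩ *
            gr I Λ m ν₀ ⟨t + 1, by omega⟩ * ge I Λ m ν₀ ν)
        (gr I Λ m ν₀ ⟨t, by omega⟩ * gr I Λ m ν₀ ⟨t + 1, by omega⟩ *
            gr I Λ m ν₀ ⟨t, by omega⟩ * ge I Λ m ν₀ ν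
          + ncEval I Λ m ν₀ (gv3 I Λ m ν₀ t h2) p *
              (gr I Λ m ν₀ ⟨t, by omega⟩ * ge I Λ m ν₀ ν)
          + ncEval I Λ m ν₀ (gv3 I Λ m ν₀ t h2) p' *
              (gr I Λ m ν₀ ⟨t + 1, by omega⟩ * ge I Λ m ν₀ ν))

/-- The Khovanov-Lauda-Rouquier algebra `R(α)`. -/
abbrev KLRAlg (I : Type) [DecidableEq I] (Λ : I → I → Type) [∀ i j, Fintype (Λ i j)]
    (m : ℕ) (ν₀ : Fin m → I) : Type :=
  RingQuot (KLRRel I Λ m ν₀)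

/-- The quotient map from the free algebra to `R(α)`. -/
noncomputable def klrMk (I : Type) [DecidableEq I] (Λ : I → I → Type)
    [∀ i j, Fintype (Λ i j)] (m : ℕ) (ν₀ : Fin m → I) :
    KLRFree I Λ m ν₀ →ₐ[HRing I Λ] KLRAlg I Λ m ν₀ :=
  RingQuot.mkAlgHom (HRing I Λ) (KLRRel I Λ m ν₀)
/-- The coefficient `∏_{a ∈ Λ_{i,j}} (x_t − x_{t+1} + ℏ_a)` in the polynomial
representation. -/
noncomputable def polCoeff (I : Type) [DecidableEq I] (Λ : I → I → Type)
    [∀ i j, Fintype (Λ i j)] (m : ℕ) (ν₀ : Fin m → I) (i j : I)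
    (t : {t : ℕ // t + 1 < m}) : MvPolynomial (Fin m) (HRing I Λ) :=
  ∏ a : Λ i j, (X (fa m t) - X (fb m t) + C (hbar I Λ i j a))

section Staircase

variable {S : Type*} [IdemSemiring S]

/-- The descending product `r (j + d - 1) * ⋯ * r (j + 1) * r j`. -/
def descProd (r : ℕ → S) : ℕ → ℕ → S
  | _, 0 => 1
  | j, d + 1 => descProd r (j + 1) d * r j

/-- The sum of the descending products from `j + d - 1` to `i`, for `j ≤ i ≤ j + d`. -/
def descSum (r : ℕ → S) : ℕ → ℕ → S
  | _, 0 => 1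
  | j, d + 1 => descSum r (j + 1) d + descProd r j (d + 1)

/-- The sum of `A * w` over all staircase words `w` in the first `k - 1` letters. -/
def staircase (A : S) (r : ℕ → S) : ℕ → S
  | 0 => A
  | k + 1 => staircase A r k * descSum r 0 k

/-- The relations of a KLR algebra over its coefficient part `A`, up to lower order terms. -/
structure BraidLike (A : S) (r : ℕ → S) : Prop where
  one_le : 1 ≤ A
  mul_self : A * A ≤ A
  comm (t : ℕ) : r t * A ≤ A * r t + A
  sq (t : ℕ) : r t * r t ≤ A * r t + A
  far (s t : ℕ) (h : s + 1 < t) : r t * r s = r s * r t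
  braid (t : ℕ) : r (t + 1) * r t * r (t + 1) ≤
    r t * r (t + 1) * r t + A * r t + A * r (t + 1) + A

variable {A M : S} {r : ℕ → S}

lemma descProd_le_descSum (r : ℕ → S) (j d : ℕ) : descProd r j d ≤ descSum r j d := by
  cases d with
  | zero => exact le_rfl
  | succ d => exact le_add_of_nonneg_left zero_le

lemma descSum_succ_le (r : ℕ → S) (j d : ℕ) : descSum r (j + 1) d ≤ descSum r j (d + 1) :=
  le_add_of_nonneg_right zero_le

lemma one_le_descSum (r : ℕ → S) (j d : ℕ) : 1 ≤ descSum r j d := by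
  induction d generalizing j with
  | zero => exact le_rfl
  | succ d ih => exact (ih _).trans (descSum_succ_le r j d)

lemma BraidLike.descProd_comm (h : BraidLike A r) {s j : ℕ} (hs : s + 1 < j) (d : ℕ) :
    descProd r j d * r s = r s * descProd r j d := by
  induction d generalizing j with
  | zero => simp [descProd]
  | succ d ih =>
    rw [descProd, mul_assoc, h.far s j hs, ← mul_assoc, ih (by omega), mul_assoc]

lemma BraidLike.descSum_comm (h : BraidLike A r) {s j : ℕ} (hs : s + 1 < j) (d : ℕ) :
    descSum r j d * r s = r s * descSum r j d := by
  induction d generalizing j with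
  | zero => simp [descSum]
  | succ d ih =>
    rw [descSum, add_mul, mul_add, ih (by omega), h.descProd_comm hs]

lemma BraidLike.mul_descSum_mul_far (h : BraidLike A r) {s j : ℕ} (hs : s + 1 < j) (d : ℕ)
    (hM : M * r s ≤ M) : M * descSum r j d * r s ≤ M * descSum r j d := by
  rw [mul_assoc, h.descSum_comm hs, ← mul_assoc]
  gcongr

lemma BraidLike.mul_descSum_mul_prev (h : BraidLike A r) (j d : ℕ)
    (hM : ∀ s, s + 1 < j + 1 + d → M * r s ≤ M) :
    M * descSum r (j + 1) d * r j ≤ M * descSum r j (d + 1) := by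
  cases d with
  | zero => simp [descSum, descProd, mul_add]
  | succ d =>
    rw [descSum, mul_add, add_mul]
    refine add_le ?_ ?_
    · refine (h.mul_descSum_mul_far (by omega) d (hM _ (by omega))).trans ?_
      gcongr
      exact (descSum_succ_le r _ _).trans (descSum_succ_le r _ _)
    · rw [mul_assoc]
      gcongr
      exact descProd_le_descSum r j (d + 2)

lemma BraidLike.mul_descSum_mul_coeff (h : BraidLike A r) (j d : ℕ) (hA : M * A ≤ M)
    (hM : ∀ s, s + 1 < j + d → M * r s ≤ M) :
    M * descSum r j d * A ≤ M * descSum r j d := by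
  induction d generalizing j with
  | zero => simpa [descSum] using hA
  | succ d ih =>
    have ih := ih (j + 1) fun s hs => hM s (by omega)
    have hprev := h.mul_descSum_mul_prev (M := M) j d fun s hs => hM s (by omega)
    have hsucc : M * descSum r (j + 1) d ≤ M * descSum r j (d + 1) := by
      gcongr; exact descSum_succ_le r _ _
    have hprod : M * descProd r (j + 1) d * A ≤ M * descSum r (j + 1) d :=
      le_trans (by gcongr; exact descProd_le_descSum r _ _) ih
    rw [show M * descSum r j (d + 1) * A =
      M * descSum r (j + 1) d * A + M * descProd r j (d + 1) * A by rw [descSum, mul_add, add_mul]]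
    refine add_le (ih.trans hsucc) ?_
    calc M * descProd r j (d + 1) * A = M * descProd r (j + 1) d * (r j * A) := by
          simp only [descProd, mul_assoc]
      _ ≤ M * descProd r (j + 1) d * (A * r j + A) := by gcongr; exact h.comm j
      _ = M * descProd r (j + 1) d * A * r j + M * descProd r (j + 1) d * A := by
          simp only [mul_add, mul_assoc]
      _ ≤ M * descSum r j (d + 1) := by
          refine add_le (le_trans ?_ hprev) (hprod.trans hsucc)
          gcongr

lemma BraidLike.mul_descSum_mul_letter (h : BraidLike A r) (j d : ℕ) (hA : M * A ≤ M)
    (hM : ∀ s, s + 1 < j + d → M * r s ≤ M) {t : ℕ} (hjt : j ≤ t) (htd : t < j + d) :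
    M * descSum r j d * r t ≤ M * descSum r j d := by
  induction d generalizing j with
  | zero => omega
  | succ d ih =>
    have hprev := h.mul_descSum_mul_prev (M := M) j d fun s hs => hM s (by omega)
    have hcoeff := h.mul_descSum_mul_coeff (M := M) (j + 1) d hA fun s hs => hM s (by omega)
    have hsucc : M * descSum r (j + 1) d ≤ M * descSum r j (d + 1) := by
      gcongr; exact descSum_succ_le r _ _
    have hprod : M * descProd r (j + 1) d ≤ M * descSum r (j + 1) d := by
      gcongr; exact descProd_le_descSum r _ _
    rw [show M * descSum r j (d + 1) * r t =
      M * descSum r (j + 1) d * r t + M * descProd r j (d + 1) * r t by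
        rw [descSum, mul_add, add_mul]]
    refine add_le ?_ ?_
    · obtain rfl | hjt := hjt.eq_or_lt
      · exact hprev
      · exact (ih (j + 1) (fun s hs => hM s (by omega)) hjt (by omega)).trans hsucc
    obtain rfl | hjt := hjt.eq_or_lt
    · calc M * descProd r j (d + 1) * r j = M * descProd r (j + 1) d * (r j * r j) := by
            simp only [descProd, mul_assoc]
        _ ≤ M * descProd r (j + 1) d * (A * r j + A) := by gcongr; exact h.sq j
        _ = M * descProd r (j + 1) d * A * r j + M * descProd r (j + 1) d * A := by
            simp only [mul_add, mul_assoc]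
        _ ≤ M * descSum r (j + 1) d * A * r j + M * descSum r (j + 1) d * A := by gcongr
        _ ≤ M * descSum r j (d + 1) :=
            add_le ((mul_le_mul_left hcoeff _).trans hprev) (hcoeff.trans hsucc)
    obtain rfl | hjt := (Nat.succ_le_of_lt hjt).eq_or_lt
    · obtain ⟨d, rfl⟩ : ∃ d', d = d' + 1 := ⟨d - 1, by omega⟩
      have hcoeff := h.mul_descSum_mul_coeff (M := M) (j + 2) d hA fun s hs => hM s (by omega)
      have hprev' := h.mul_descSum_mul_prev (M := M) (j + 1) d fun s hs => hM s (by omega)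
      have hfar := h.mul_descSum_mul_far (M := M) (s := j) (j := j + 2) (by omega) d
        (hM _ (by omega))
      have hsucc' : M * descSum r (j + 2) d ≤ M * descSum r (j + 1) (d + 1) := by
        gcongr; exact descSum_succ_le r _ _
      have hprod' : M * descProd r (j + 2) d * A ≤ M * descSum r (j + 2) d :=
        le_trans (by gcongr; exact descProd_le_descSum r _ _) hcoeff
      calc M * descProd r j (d + 1 + 1) * r (j + 1)
          = M * descProd r (j + 2) d * (r (j + 1) * r j * r (j + 1)) := by
            simp only [descProd, mul_assoc]
        _ ≤ M * descProd r (j + 2) d *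
              (r j * r (j + 1) * r j + A * r j + A * r (j + 1) + A) := by
            gcongr; exact h.braid j
        _ = M * (descProd r (j + 2) d * r j) * (r (j + 1) * r j)
              + M * descProd r (j + 2) d * A * r j
              + M * descProd r (j + 2) d * A * r (j + 1) + M * descProd r (j + 2) d * A := by
            simp only [mul_add, mul_assoc]
        _ = M * r j * descProd r j (d + 1 + 1) + M * descProd r (j + 2) d * A * r j
              + M * descProd r (j + 2) d * A * r (j + 1) + M * descProd r (j + 2) d * A := by
            rw [h.descProd_comm (by omega)]
            simp only [descProd, mul_assoc]
        _ ≤ M * descSum r j (d + 1 + 1) := by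
            refine add_le (add_le (add_le ?_ ?_) ?_) ?_
            · exact mul_le_mul' (hM _ (by omega)) (descProd_le_descSum r _ _)
            · exact (mul_le_mul_left hprod' _).trans (hfar.trans (hsucc'.trans hsucc))
            · exact (mul_le_mul_left hprod' _).trans (hprev'.trans hsucc)
            · exact hprod'.trans (hsucc'.trans hsucc)
    · calc M * descProd r j (d + 1) * r t = M * descProd r (j + 1) d * r t * r j := by
            simp only [descProd, mul_assoc]
            rw [h.far j t hjt]
        _ ≤ M * descSum r (j + 1) d * r t * r j := by gcongr
        _ ≤ M * descSum r (j + 1) d * r j := by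
            exact mul_le_mul_left
              (ih (j + 1) (fun s hs => hM s (by omega)) (by omega) (by omega)) _
        _ ≤ M * descSum r j (d + 1) := hprev

lemma BraidLike.staircase_mul_le (h : BraidLike A r) (k : ℕ) :
    staircase A r k * A ≤ staircase A r k ∧
      ∀ t, t + 1 < k → staircase A r k * r t ≤ staircase A r k := by
  induction k with
  | zero => exact ⟨h.mul_self, fun t ht => by omega⟩
  | succ k ih =>
    refine ⟨h.mul_descSum_mul_coeff 0 k ih.1 fun s hs => ih.2 s (by omega), fun t ht => ?_⟩
    exact h.mul_descSum_mul_letter 0 k ih.1 (fun s hs => ih.2 s (by omega)) t.zero_le (by omega)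

lemma BraidLike.one_le_staircase (h : BraidLike A r) (k : ℕ) : 1 ≤ staircase A r k := by
  induction k with
  | zero => exact h.one_le
  | succ k ih => simpa [staircase] using mul_le_mul' ih (one_le_descSum r 0 k)

lemma exists_descProd_eq_word (r : ℕ → S) (j d : ℕ) :
    ∃ w : List ℕ, (∀ t ∈ w, t < j + d) ∧ descProd r j d = (w.map r).prod := by
  induction d generalizing j with
  | zero => exact ⟨[], by simp, by simp [descProd]⟩
  | succ d ih =>
    obtain ⟨w, hw, hr⟩ := ih (j + 1)
    refine ⟨w ++ [j], ?_, by simp [descProd, hr]⟩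
    intro t ht
    rcases List.mem_append.1 ht with ht | ht
    · have := hw t ht
      omega
    · simp at ht
      omega

lemma exists_descSum_eq_sum_word (r : ℕ → S) (j d : ℕ) :
    ∃ w : Fin (d + 1) → List ℕ, (∀ i, ∀ t ∈ w i, t < j + d) ∧
      descSum r j d = ∑ i, ((w i).map r).prod := by
  induction d generalizing j with
  | zero => exact ⟨fun _ => [], by simp, by simp [descSum]⟩
  | succ d ih =>
    obtain ⟨w, hw, hr⟩ := ih (j + 1)
    obtain ⟨v, hv, hp⟩ := exists_descProd_eq_word r j (d + 1)
    refine ⟨Fin.cons v w, ?_, by simp [descSum, hr, hp, Fin.sum_univ_succ, add_comm]⟩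
    intro i t ht
    cases i using Fin.cases with
    | zero => exact hv t ht
    | succ i =>
      have := hw i t ht
      omega

/-- The staircase sum has `k!` terms. -/
lemma exists_staircase_eq_sum_word (A : S) (r : ℕ → S) (k : ℕ) :
    ∃ (ι : Type) (_ : Fintype ι) (w : ι → List ℕ), Fintype.card ι = k.factorial ∧
      (∀ i, ∀ t ∈ w i, t + 1 < k) ∧ staircase A r k = ∑ i, A * ((w i).map r).prod := by
  induction k with
  | zero => exact ⟨Unit, inferInstance, fun _ => [], by simp, by simp, by simp [staircase]⟩
  | succ k ih =>
    obtain ⟨ι, _, w, hc, hw, hr⟩ := ih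
    obtain ⟨v, hv, hs⟩ := exists_descSum_eq_sum_word r 0 k
    refine ⟨ι × Fin (k + 1), inferInstance, fun p => w p.1 ++ v p.2, ?_, ?_, ?_⟩
    · simp [hc, Nat.factorial_succ, mul_comm]
    · intro p t ht
      rcases List.mem_append.1 ht with ht | ht
      · have := hw _ t ht
        omega
      · have := hv _ t ht
        omega
    · simp [staircase, hr, hs, Finset.sum_mul_sum, Fintype.sum_prod_type, mul_assoc]

end Staircase

section Intertwiner

variable {I L : Type*} [DecidableEq I] [Field L]

/-- The operator through which `r_t` acts on rational functions: `s` is the transposition of the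
variables `u` and `v`, and `i`, `j` are the labels at positions `t` and `t + 1`. -/
def intertwiner (A : I → I → L → L) (s : L →+* L) (u v : L) (i j : I) (F : L) : L :=
  A i j (u - v) * if i = j then (s F - F) / (u - v) else s F

variable {A : I → I → L → L} {s s' s₁ s₂ : L →+* L} {u v u' v' x y z : L} {i j k l : I}

lemma intertwiner_self (F : L) :
    intertwiner A s u v i i F = A i i (u - v) * ((s F - F) / (u - v)) := by
  simp [intertwiner]

lemma intertwiner_of_ne (h : i ≠ j) (F : L) :
    intertwiner A s u v i j F = A i j (u - v) * s F := by
  simp [intertwiner, h]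

lemma intertwiner_mul_of_fixed {a : L} (ha : s a = a) (F : L) :
    intertwiner A s u v i j (a * F) = a * intertwiner A s u v i j F := by
  simp only [intertwiner, map_mul, ha]
  split_ifs <;> ring

lemma intertwiner_mul_left_of_ne (h : i ≠ j) (hu : s u = v) (F : L) :
    intertwiner A s u v i j (u * F) = v * intertwiner A s u v i j F := by
  simp only [intertwiner_of_ne h, map_mul, hu]
  ring

lemma intertwiner_mul_right_of_ne (h : i ≠ j) (hv : s v = u) (F : L) :
    intertwiner A s u v i j (v * F) = u * intertwiner A s u v i j F := by
  simp only [intertwiner_of_ne h, map_mul, hv]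
  ring

lemma intertwiner_mul_left_self (huv : u ≠ v) (hu : s u = v) (F : L) :
    intertwiner A s u v i i (u * F) =
      v * intertwiner A s u v i i F - A i i (u - v) * F := by
  have : u - v ≠ 0 := sub_ne_zero.2 huv
  simp only [intertwiner_self, map_mul, hu]
  field_simp
  ring

lemma intertwiner_mul_right_self (huv : u ≠ v) (hv : s v = u) (F : L) :
    intertwiner A s u v i i (v * F) =
      u * intertwiner A s u v i i F + A i i (u - v) * F := by
  have : u - v ≠ 0 := sub_ne_zero.2 huv
  simp only [intertwiner_self, map_mul, hv]
  field_simp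
  ring

lemma intertwiner_sq_self (huv : u ≠ v) (hu : s u = v) (hv : s v = u) (hss : ∀ F, s (s F) = F)
    (hA : ∀ i j w, s (A i j w) = A i j (s w)) {g : L}
    (hg : (u - v) * g = A i i (v - u) - A i i (u - v)) (F : L) :
    intertwiner A s u v i i (intertwiner A s u v i i F) = g * intertwiner A s u v i i F := by
  have h : u - v ≠ 0 := sub_ne_zero.2 huv
  have h' : v - u ≠ 0 := sub_ne_zero.2 huv.symm
  obtain rfl : g = (A i i (v - u) - A i i (u - v)) / (u - v) := by
    rw [eq_div_iff h, mul_comm, hg]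
  simp only [intertwiner_self, map_mul, map_div₀, map_sub, hu, hv, hss, hA]
  rw [← neg_sub u v, div_neg]
  field_simp
  ring

lemma intertwiner_sq_of_ne (hij : i ≠ j) (hu : s u = v) (hv : s v = u)
    (hss : ∀ F, s (s F) = F) (hA : ∀ i j w, s (A i j w) = A i j (s w)) (F : L) :
    intertwiner A s u v j i (intertwiner A s u v i j F) =
      A i j (v - u) * A j i (u - v) * F := by
  simp only [intertwiner_of_ne hij, intertwiner_of_ne hij.symm, map_mul, map_sub, hu, hv, hss, hA]
  ring

lemma intertwiner_comm (hss : ∀ F, s (s' F) = s' (s F)) (hu : s' u = u) (hv : s' v = v)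
    (hu' : s u' = u') (hv' : s v' = v') (hA : ∀ i j w, s (A i j w) = A i j (s w))
    (hA' : ∀ i j w, s' (A i j w) = A i j (s' w)) (F : L) :
    intertwiner A s u v i j (intertwiner A s' u' v' k l F) =
      intertwiner A s' u' v' k l (intertwiner A s u v i j F) := by
  simp only [intertwiner, map_mul, map_sub, hu, hv, hu', hv', hA, hA', hss, map_div₀,
    apply_ite s, apply_ite s']
  split_ifs <;> ring

/-- Automorphisms `s₁ = (x y)` and `s₂ = (y z)` permuting three distinct elements and commuting
with the coefficient functions. -/
structure BraidData (A : I → I → L → L) (s₁ s₂ : L →+* L) (x y z : L) : Prop where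
  ne₁₂ : x ≠ y
  ne₁₃ : x ≠ z
  ne₂₃ : y ≠ z
  s₁_x : s₁ x = y
  s₁_y : s₁ y = x
  s₁_z : s₁ z = z
  s₂_x : s₂ x = x
  s₂_y : s₂ y = z
  s₂_z : s₂ z = y
  s₁_s₁ (F : L) : s₁ (s₁ F) = F
  s₂_s₂ (F : L) : s₂ (s₂ F) = F
  braid (F : L) : s₂ (s₁ (s₂ F)) = s₁ (s₂ (s₁ F))
  s₁_coeff (i j : I) (w : L) : s₁ (A i j w) = A i j (s₁ w)
  s₂_coeff (i j : I) (w : L) : s₂ (A i j w) = A i j (s₂ w)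

lemma BraidData.intertwiner_braid_of_ne (h : BraidData A s₁ s₂ x y z) (hik : i ≠ k) (F : L) :
    intertwiner A s₂ y z i j (intertwiner A s₁ x y i k (intertwiner A s₂ y z j k F)) =
      intertwiner A s₁ x y j k (intertwiner A s₂ y z i k (intertwiner A s₁ x y i j F)) := by
  by_cases hij : i = j
  · subst hij
    simp only [intertwiner_self, intertwiner_of_ne hik, map_mul, map_div₀, map_sub, h.s₁_x, h.s₁_y,
      h.s₁_z, h.s₂_x, h.s₂_y, h.s₂_z, h.braid, h.s₁_coeff, h.s₂_coeff]
    ring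
  by_cases hjk : j = k
  · subst hjk
    simp only [intertwiner_self, intertwiner_of_ne hik, map_mul, map_div₀, map_sub, h.s₁_x, h.s₁_y,
      h.s₁_z, h.s₂_x, h.s₂_y, h.s₂_z, h.braid, h.s₁_coeff, h.s₂_coeff]
    ring
  · simp only [intertwiner_of_ne hik, intertwiner_of_ne hij, intertwiner_of_ne hjk, map_mul,
      map_sub, h.s₁_x, h.s₁_y,
      h.s₁_z, h.s₂_x, h.s₂_y, h.s₂_z, h.braid, h.s₁_coeff, h.s₂_coeff]
    ring

lemma BraidData.intertwiner_braid_of_eq_of_ne (h : BraidData A s₁ s₂ x y z) (hij : i ≠ j) {q : L}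
    (hq : (x - z) * q = A i j (y - x) * A j i (x - y) - A i j (y - z) * A j i (z - y)) (F : L) :
    intertwiner A s₂ y z i j (intertwiner A s₁ x y i i (intertwiner A s₂ y z j i F)) =
      intertwiner A s₁ x y j i (intertwiner A s₂ y z i i (intertwiner A s₁ x y i j F)) +
        A i i (x - z) * q * F := by
  have h13 : x - z ≠ 0 := sub_ne_zero.2 h.ne₁₃
  obtain rfl : q = (A i j (y - x) * A j i (x - y) - A i j (y - z) * A j i (z - y)) / (x - z) := by
    rw [eq_div_iff h13, mul_comm, hq]
  simp only [intertwiner_self, intertwiner_of_ne hij, intertwiner_of_ne hij.symm, map_mul,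
    map_div₀, map_sub, h.s₁_x, h.s₁_y,
    h.s₁_z, h.s₂_x, h.s₂_y, h.s₂_z, h.s₁_s₁, h.s₂_s₂, h.braid, h.s₁_coeff, h.s₂_coeff]
  field_simp
  ring

lemma BraidData.intertwiner_braid_of_eq (h : BraidData A s₁ s₂ x y z) {p p' : L}
    (hp : ((x - y) * ((x - z) * (y - z))) * p =
      A i i (y - x) * A i i (x - z) * (y - z) + A i i (x - z) * A i i (y - z) * (x - y)
        - A i i (x - y) * A i i (y - z) * (x - z))
    (hp' : ((x - y) * ((x - z) * (y - z))) * p' =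
      -(A i i (x - y) * A i i (x - z) * (y - z)) - A i i (x - z) * A i i (z - y) * (x - y)
        + A i i (x - y) * A i i (y - z) * (x - z)) (F : L) :
    intertwiner A s₂ y z i i (intertwiner A s₁ x y i i (intertwiner A s₂ y z i i F)) =
      intertwiner A s₁ x y i i (intertwiner A s₂ y z i i (intertwiner A s₁ x y i i F)) +
        p * intertwiner A s₁ x y i i F + p' * intertwiner A s₂ y z i i F := by
  have h12 : x - y ≠ 0 := sub_ne_zero.2 h.ne₁₂
  have h13 : x - z ≠ 0 := sub_ne_zero.2 h.ne₁₃
  have h23 : y - z ≠ 0 := sub_ne_zero.2 h.ne₂₃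
  have hD : (x - y) * ((x - z) * (y - z)) ≠ 0 := mul_ne_zero h12 (mul_ne_zero h13 h23)
  obtain rfl := eq_div_of_mul_eq hD ((mul_comm _ _).trans hp)
  obtain rfl := eq_div_of_mul_eq hD ((mul_comm _ _).trans hp')
  simp only [intertwiner_self, map_mul, map_div₀, map_sub, h.s₁_x, h.s₁_y,
    h.s₁_z, h.s₂_x, h.s₂_y, h.s₂_z, h.s₁_s₁, h.s₂_s₂, h.braid, h.s₁_coeff, h.s₂_coeff]
  rw [show z - y = -(y - z) by ring, show y - x = -(x - y) by ring]
  simp only [div_neg]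
  generalize A i i (-(x - y)) = a₂₁, A i i (-(y - z)) = a₃₂, A i i (x - y) = a₁₂,
    A i i (y - z) = a₂₃, A i i (x - z) = a₁₃, s₁ (s₂ (s₁ F)) = F₁₂₁, s₁ (s₂ F) = F₁₂,
    s₂ (s₁ F) = F₂₁, s₁ F = F₁, s₂ F = F₂
  field_simp
  ring

end Intertwiner

section DividedDifference

lemma X_sub_X_ne_zero {σ H : Type*} [CommRing H] [Nontrivial H] {a b : σ} (hab : a ≠ b) :
    (X a - X b : MvPolynomial σ H) ≠ 0 :=
  sub_ne_zero.2 fun h => hab (X_injective h)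

variable {σ H : Type*} [DecidableEq σ] [CommRing H]

lemma X_sub_X_dvd_rename_swap_sub (a b : σ) (f : MvPolynomial σ H) :
    X a - X b ∣ rename (Equiv.swap a b) f - f := by
  induction f using MvPolynomial.induction_on with
  | C c => simp
  | add p q hp hq =>
    rw [map_add, add_sub_add_comm]
    exact dvd_add hp hq
  | mul_X p k hp =>
    have hk : (X a - X b : MvPolynomial σ H) ∣ X (Equiv.swap a b k) - X k := by
      rcases eq_or_ne k a with rfl | hka
      · exact ⟨-1, by rw [Equiv.swap_apply_left]; ring⟩
      rcases eq_or_ne k b with rfl | hkb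
      · rw [Equiv.swap_apply_right]
      · simp [Equiv.swap_apply_of_ne_of_ne hka hkb]
    rw [map_mul, rename_X, show rename (Equiv.swap a b) p * X (Equiv.swap a b k) - p * X k =
      (rename (Equiv.swap a b) p - p) * X (Equiv.swap a b k) +
        p * (X (Equiv.swap a b k) - X k) by ring]
    exact dvd_add (hp.mul_right _) (hk.mul_left _)

variable [IsDomain H] {a b : σ}

/-- The divided difference `f ↦ (s f - f) / (X a - X b)`, with `s` the transposition of `a`
and `b`. -/
noncomputable def dividedDiff (hab : a ≠ b) : MvPolynomial σ H →ₗ[H] MvPolynomial σ H where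
  toFun f := (X_sub_X_dvd_rename_swap_sub a b f).choose
  map_add' f g := by
    apply mul_left_cancel₀ (X_sub_X_ne_zero hab)
    rw [mul_add, ← (X_sub_X_dvd_rename_swap_sub a b f).choose_spec,
      ← (X_sub_X_dvd_rename_swap_sub a b g).choose_spec,
      ← (X_sub_X_dvd_rename_swap_sub a b (f + g)).choose_spec, map_add]
    ring
  map_smul' c f := by
    apply mul_left_cancel₀ (X_sub_X_ne_zero hab)
    rw [mul_smul_comm, RingHom.id_apply, ← (X_sub_X_dvd_rename_swap_sub a b f).choose_spec,
      ← (X_sub_X_dvd_rename_swap_sub a b (c • f)).choose_spec, map_smul, smul_sub]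

lemma X_sub_X_mul_dividedDiff (hab : a ≠ b) (f : MvPolynomial σ H) :
    (X a - X b) * dividedDiff hab f = rename (Equiv.swap a b) f - f :=
  (X_sub_X_dvd_rename_swap_sub a b f).choose_spec.symm

end DividedDifference

section PermFrac

variable {σ H : Type*} [CommRing H] [IsDomain H]

/-- The action of a permutation of the variables on rational functions. -/
noncomputable def permFrac (w : Equiv.Perm σ) :
    FractionRing (MvPolynomial σ H) →+* FractionRing (MvPolynomial σ H) :=
  IsFractionRing.map (j := (rename w : MvPolynomial σ H →ₐ[H] MvPolynomial σ H).toRingHom)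
    (rename_injective w w.injective)

lemma permFrac_algebraMap (w : Equiv.Perm σ) (f : MvPolynomial σ H) :
    permFrac w (algebraMap _ (FractionRing (MvPolynomial σ H)) f) =
      algebraMap _ _ (rename w f) := by
  simp [permFrac, IsFractionRing.map]

lemma permFrac_permFrac (w w' : Equiv.Perm σ) (F : FractionRing (MvPolynomial σ H)) :
    permFrac w (permFrac w' F) = permFrac (w * w') F := by
  have : (permFrac w).comp (permFrac w') =
      (permFrac (w * w') : FractionRing (MvPolynomial σ H) →+* _) := by
    apply IsLocalization.ringHom_ext (nonZeroDivisors (MvPolynomial σ H))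
    ext f <;> simp [permFrac_algebraMap]
  exact DFunLike.congr_fun this F

lemma permFrac_one (F : FractionRing (MvPolynomial σ H)) : permFrac 1 F = F := by
  have : (permFrac 1 : FractionRing (MvPolynomial σ H) →+* _) = RingHom.id _ := by
    apply IsLocalization.ringHom_ext (nonZeroDivisors (MvPolynomial σ H))
    ext f <;> simp [permFrac_algebraMap]
  exact DFunLike.congr_fun this F

end PermFrac

section Swap

variable {ι : Type*} [DecidableEq ι] {a b c d : ι}

lemma swap_mul_swap_comm (hca : c ≠ a) (hcb : c ≠ b) (hda : d ≠ a) (hdb : d ≠ b) :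
    Equiv.swap a b * Equiv.swap c d = Equiv.swap c d * Equiv.swap a b := by
  rw [Equiv.mul_swap_eq_swap_mul, Equiv.swap_apply_of_ne_of_ne hca hcb,
    Equiv.swap_apply_of_ne_of_ne hda hdb]

lemma swap_braid (hab : a ≠ b) (hac : a ≠ c) (hbc : b ≠ c) :
    Equiv.swap b c * Equiv.swap a b * Equiv.swap b c =
      Equiv.swap a b * Equiv.swap b c * Equiv.swap a b := by
  rw [Equiv.mul_swap_eq_swap_mul (Equiv.swap b c), Equiv.mul_swap_eq_swap_mul (Equiv.swap a b),
    Equiv.swap_apply_of_ne_of_ne hab hac, Equiv.swap_apply_left, Equiv.swap_apply_right,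
    Equiv.swap_apply_of_ne_of_ne hac.symm hbc.symm, mul_assoc, mul_assoc, Equiv.swap_mul_self,
    Equiv.swap_mul_self]

end Swap

section RationalFunctions

variable {I : Type} {Λ : I → I → Type} {m : ℕ}

variable (Λ) in
/-- The field of rational functions in `x_1, …, x_m` over `ℍ`. -/
abbrev KLRFrac (m : ℕ) : Type := FractionRing (MvPolynomial (Fin m) (HRing I Λ))

variable (Λ m) in
/-- The variable `x_k` as a rational function. -/
noncomputable abbrev fracX (k : Fin m) : KLRFrac Λ m :=
  algebraMap (MvPolynomial (Fin m) (HRing I Λ)) _ (X k)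

lemma fracX_injective : Function.Injective (fracX Λ m) :=
  (FaithfulSMul.algebraMap_injective _ _).comp X_injective

lemma permFrac_fracX (w : Equiv.Perm (Fin m)) (k : Fin m) :
    permFrac w (fracX Λ m k) = fracX Λ m (w k) := by
  simp [fracX, permFrac_algebraMap]

variable [∀ i j, Fintype (Λ i j)]

variable (Λ m) in
/-- The function `u ↦ ∏_{a ∈ Λ_{i,j}} (u + ℏ_a)` on rational functions. -/
noncomputable def fracCoeff (i j : I) (u : KLRFrac Λ m) : KLRFrac Λ m :=
  ∏ a : Λ i j, (u + algebraMap (MvPolynomial (Fin m) (HRing I Λ)) _ (C (hbar I Λ i j a)))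

lemma permFrac_fracCoeff (w : Equiv.Perm (Fin m)) (i j : I) (u : KLRFrac Λ m) :
    permFrac w (fracCoeff Λ m i j u) = fracCoeff Λ m i j (permFrac w u) := by
  simp [fracCoeff, permFrac_algebraMap]

end RationalFunctions

section Representation

variable {I : Type} [DecidableEq I] {Λ : I → I → Type} {m : ℕ} {ν₀ : Fin m → I}

lemma fa_ne_fb (t : {t : ℕ // t + 1 < m}) : fa m t ≠ fb m t := by
  simp [fa, fb]

lemma sAct_apply (t : {t : ℕ // t + 1 < m}) (ν : Idx I m ν₀) (k : Fin m) :
    (sAct I m ν₀ t ν).1 k = ν.1 (Equiv.swap (fa m t) (fb m t) k) :=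
  rfl

lemma sAct_sAct (t : {t : ℕ // t + 1 < m}) (ν : Idx I m ν₀) :
    sAct I m ν₀ t (sAct I m ν₀ t ν) = ν := by
  ext k
  simp [sAct_apply]

lemma sAct_eq_self_iff (t : {t : ℕ // t + 1 < m}) (ν : Idx I m ν₀) :
    sAct I m ν₀ t ν = ν ↔ ν.1 (fa m t) = ν.1 (fb m t) := by
  refine ⟨fun h => ?_, fun h => ?_⟩
  · have := congrFun (congrArg Subtype.val h) (fb m t)
    rwa [sAct_apply, Equiv.swap_apply_right] at this
  · ext k
    rw [sAct_apply, Equiv.swap_apply_def]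
    split_ifs with h₁ h₂
    · rw [h₁, h]
    · rw [h₂, h]
    · rfl

lemma swap_far {t s : {t : ℕ // t + 1 < m}} (h : t.1 + 1 < s.1 ∨ s.1 + 1 < t.1) :
    Equiv.swap (fa m t) (fb m t) * Equiv.swap (fa m s) (fb m s) =
      Equiv.swap (fa m s) (fb m s) * Equiv.swap (fa m t) (fb m t) := by
  apply swap_mul_swap_comm <;> simp only [fa, fb, ne_eq, Fin.mk.injEq] <;> omega

lemma swap_fa_fb_braid {t : ℕ} (h : t + 2 < m) :
    Equiv.swap (fa m ⟨t + 1, by omega⟩) (fb m ⟨t + 1, by omega⟩) *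
        Equiv.swap (fa m ⟨t, by omega⟩) (fb m ⟨t, by omega⟩) *
        Equiv.swap (fa m ⟨t + 1, by omega⟩) (fb m ⟨t + 1, by omega⟩) =
      Equiv.swap (fa m ⟨t, by omega⟩) (fb m ⟨t, by omega⟩) *
        Equiv.swap (fa m ⟨t + 1, by omega⟩) (fb m ⟨t + 1, by omega⟩) *
        Equiv.swap (fa m ⟨t, by omega⟩) (fb m ⟨t, by omega⟩) := by
  apply swap_braid <;> simp only [fa, fb, ne_eq, Fin.mk.injEq] <;> omega

lemma sAct_comm {t s : {t : ℕ // t + 1 < m}} (h : t.1 + 1 < s.1 ∨ s.1 + 1 < t.1)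
    (ν : Idx I m ν₀) :
    sAct I m ν₀ t (sAct I m ν₀ s ν) = sAct I m ν₀ s (sAct I m ν₀ t ν) := by
  ext k
  have := swap_far h
  simp only [sAct_apply, ← Equiv.Perm.mul_apply, this]

lemma sAct_braid {t : ℕ} (h : t + 2 < m) (ν : Idx I m ν₀) :
    sAct I m ν₀ ⟨t + 1, by omega⟩ (sAct I m ν₀ ⟨t, by omega⟩ (sAct I m ν₀ ⟨t + 1, by omega⟩ ν)) =
      sAct I m ν₀ ⟨t, by omega⟩ (sAct I m ν₀ ⟨t + 1, by omega⟩ (sAct I m ν₀ ⟨t, by omega⟩ ν)) := by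
  ext k
  have := swap_fa_fb_braid h
  simp only [sAct_apply, ← Equiv.Perm.mul_apply, ← mul_assoc, this]

variable (Λ ν₀) in
/-- The space `Pol(α)`. -/
abbrev KLRPol : Type := Idx I m ν₀ → MvPolynomial (Fin m) (HRing I Λ)

variable (Λ) in
/-- The action of `e(ν)` on `Pol(α)`. -/
noncomputable def opE (ν : Idx I m ν₀) : Module.End (HRing I Λ) (KLRPol Λ ν₀) :=
  LinearMap.single _ _ ν ∘ₗ LinearMap.proj ν

variable (Λ ν₀) in
/-- The action of a polynomial on `Pol(α)`. -/
noncomputable def opMul :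
    MvPolynomial (Fin m) (HRing I Λ) →ₐ[HRing I Λ] Module.End (HRing I Λ) (KLRPol Λ ν₀) :=
  Algebra.lsmul _ _ _

lemma opE_single_self (ν : Idx I m ν₀) (f : MvPolynomial (Fin m) (HRing I Λ)) :
    opE Λ ν (Pi.single ν f) = Pi.single ν f := by
  simp [opE]

lemma opE_single_of_ne {ν μ : Idx I m ν₀} (h : ν ≠ μ) (f : MvPolynomial (Fin m) (HRing I Λ)) :
    opE Λ ν (Pi.single μ f) = 0 := by
  simp [opE, h]

lemma opMul_single (p : MvPolynomial (Fin m) (HRing I Λ)) (ν : Idx I m ν₀)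
    (f : MvPolynomial (Fin m) (HRing I Λ)) :
    opMul Λ ν₀ p (Pi.single ν f) = Pi.single ν (p * f) := by
  rw [← smul_eq_mul, Pi.single_smul']
  rfl

variable [∀ i j, Fintype (Λ i j)]

lemma fracCoeff_fracX_sub (i j : I) (t : {t : ℕ // t + 1 < m}) :
    fracCoeff Λ m i j (fracX Λ m (fa m t) - fracX Λ m (fb m t)) =
      algebraMap _ _ (polCoeff I Λ m ν₀ i j t) := by
  simp [fracCoeff, polCoeff]

lemma polCoeff_ne_zero (i j : I) (t : {t : ℕ // t + 1 < m}) : polCoeff I Λ m ν₀ i j t ≠ 0 := by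
  rw [polCoeff, Finset.prod_ne_zero_iff]
  intro a _ h
  have := congrArg (aeval (Pi.single (fa m t) (1 - hbar I Λ i j a))) h
  simp [(fa_ne_fb t).symm] at this

variable (Λ ν₀) in
/-- The operator on polynomials through which `r_t` acts on a component with labels `i`, `j` at
positions `t`, `t + 1`. -/
noncomputable def polIntertwiner (t : {t : ℕ // t + 1 < m}) (i j : I) :
    MvPolynomial (Fin m) (HRing I Λ) →ₗ[HRing I Λ] MvPolynomial (Fin m) (HRing I Λ) :=
  LinearMap.mulLeft _ (polCoeff I Λ m ν₀ i j t) ∘ₗ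
    if i = j then dividedDiff (fa_ne_fb t)
    else (rename (Equiv.swap (fa m t) (fb m t))).toLinearMap

/-- The operator `polIntertwiner` extended to rational functions. -/
noncomputable abbrev fracIntertwiner (t : {t : ℕ // t + 1 < m}) (i j : I) (F : KLRFrac Λ m) :
    KLRFrac Λ m :=
  intertwiner (fracCoeff Λ m) (permFrac (Equiv.swap (fa m t) (fb m t)))
    (fracX Λ m (fa m t)) (fracX Λ m (fb m t)) i j F

lemma algebraMap_polIntertwiner (t : {t : ℕ // t + 1 < m}) (i j : I)
    (f : MvPolynomial (Fin m) (HRing I Λ)) :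
    algebraMap _ (KLRFrac Λ m) (polIntertwiner Λ ν₀ t i j f) =
      fracIntertwiner t i j (algebraMap _ _ f) := by
  rw [fracIntertwiner, intertwiner, fracCoeff_fracX_sub (ν₀ := ν₀), polIntertwiner]
  split_ifs with h
  · rw [LinearMap.comp_apply, LinearMap.mulLeft_apply, map_mul]
    congr 1
    rw [eq_div_iff (sub_ne_zero.2 (fracX_injective.ne (fa_ne_fb t))), permFrac_algebraMap,
      ← map_sub, ← map_sub, ← X_sub_X_mul_dividedDiff (fa_ne_fb t), ← map_mul, mul_comm]
  · simp [permFrac_algebraMap]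

variable (Λ ν₀) in
/-- The action of `r_t` on `Pol(α)`. -/
noncomputable def opR (t : {t : ℕ // t + 1 < m}) : Module.End (HRing I Λ) (KLRPol Λ ν₀) :=
  LinearMap.pi fun μ =>
    polIntertwiner Λ ν₀ t (μ.1 (fb m t)) (μ.1 (fa m t)) ∘ₗ LinearMap.proj (sAct I m ν₀ t μ)

lemma opR_single (t : {t : ℕ // t + 1 < m}) (ν : Idx I m ν₀)
    (f : MvPolynomial (Fin m) (HRing I Λ)) :
    opR Λ ν₀ t (Pi.single ν f) = Pi.single (sAct I m ν₀ t ν)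
      (polIntertwiner Λ ν₀ t (ν.1 (fa m t)) (ν.1 (fb m t)) f) := by
  ext1 μ
  rcases eq_or_ne μ (sAct I m ν₀ t ν) with rfl | h
  · simp [opR, sAct_sAct, sAct_apply]
  · have h' : sAct I m ν₀ t μ ≠ ν := by
      rintro rfl
      exact h (sAct_sAct t μ).symm
    simp [opR, h, h']

end Representation

section FracEval

variable {I : Type} {Λ : I → I → Type} {m : ℕ}

lemma fracX_ne {k l : Fin m} (h : k ≠ l) : fracX Λ m k ≠ fracX Λ m l :=
  fracX_injective.ne h

lemma permFrac_swap_swap (k l : Fin m) (F : KLRFrac Λ m) :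
    permFrac (Equiv.swap k l) (permFrac (Equiv.swap k l) F) = F := by
  rw [permFrac_permFrac, Equiv.swap_mul_self, permFrac_one]

/-- Substitution of polynomials for the three variables of the coefficient polynomials, with
values in rational functions. -/
noncomputable def fracEval (h : Fin 3 → MvPolynomial (Fin m) (HRing I Λ)) :
    CPol I Λ →+* KLRFrac Λ m :=
  (algebraMap _ _).comp (aeval h : CPol I Λ →ₐ[HRing I Λ] _).toRingHom

lemma fracEval_apply (h : Fin 3 → MvPolynomial (Fin m) (HRing I Λ)) (p : CPol I Λ) :
    fracEval h p = algebraMap _ _ (aeval h p) :=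
  rfl

lemma fracEval_X (h : Fin 3 → MvPolynomial (Fin m) (HRing I Λ)) (a : Fin 3) :
    fracEval h (X a) = algebraMap _ _ (h a) := by
  simp [fracEval]

variable [∀ i j, Fintype (Λ i j)]

lemma fracEval_Pc (h : Fin 3 → MvPolynomial (Fin m) (HRing I Λ)) (i : I) (u v : CPol I Λ) :
    fracEval h (Pc I Λ i u v) = fracCoeff Λ m i i (fracEval h u - fracEval h v) := by
  simp [Pc, fracEval, fracCoeff, algebraMap_eq]

end FracEval

section Relations

variable {I : Type} [DecidableEq I] {Λ : I → I → Type} {m : ℕ} {ν₀ : Fin m → I}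

lemma end_ext_of_component (ν : Idx I m ν₀) {F G : Module.End (HRing I Λ) (KLRPol Λ ν₀)}
    (hne : ∀ μ, ν ≠ μ → ∀ f, F (Pi.single μ f) = G (Pi.single μ f))
    (hν : ∀ f, F (Pi.single ν f) = G (Pi.single ν f)) : F = G := by
  refine LinearMap.pi_ext fun μ f => ?_
  rcases eq_or_ne ν μ with rfl | h
  · exact hν f
  · exact hne μ h f

lemma map_ncEval {E : KLRFree I Λ m ν₀ →ₐ[HRing I Λ] Module.End (HRing I Λ) (KLRPol Λ ν₀)}
    {g : Fin 3 → KLRFree I Λ m ν₀} {h : Fin 3 → MvPolynomial (Fin m) (HRing I Λ)}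
    (hg : ∀ i, E (g i) = opMul Λ ν₀ (h i)) (p : CPol I Λ) :
    E (ncEval I Λ m ν₀ g p) = opMul Λ ν₀ (aeval h p) := by
  rw [ncEval, map_sum, aeval_def, eval₂_eq', map_sum]
  refine Finset.sum_congr rfl fun s _ => ?_
  simp only [map_mul, AlgHom.commutes, map_pow, hg, Fin.prod_univ_three, mul_assoc]

variable [∀ i j, Fintype (Λ i j)]

variable (Λ ν₀) in
/-- The action of the generators on `Pol(α)`. -/
noncomputable def opGen : KLRGen I m ν₀ → Module.End (HRing I Λ) (KLRPol Λ ν₀)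
  | .e ν => opE Λ ν
  | .x k => opMul Λ ν₀ (X k)
  | .r t => opR Λ ν₀ t

variable (Λ ν₀) in
/-- The action of the free algebra on `Pol(α)`. -/
noncomputable def freeRep :
    KLRFree I Λ m ν₀ →ₐ[HRing I Λ] Module.End (HRing I Λ) (KLRPol Λ ν₀) :=
  FreeAlgebra.lift _ (opGen Λ ν₀)

lemma freeRep_ge (ν : Idx I m ν₀) : freeRep Λ ν₀ (ge I Λ m ν₀ ν) = opE Λ ν := by
  simp [freeRep, ge, opGen]

lemma freeRep_gx (k : Fin m) : freeRep Λ ν₀ (gx I Λ m ν₀ k) = opMul Λ ν₀ (X k) := by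
  simp [freeRep, gx, opGen]

lemma freeRep_gr (t : {t : ℕ // t + 1 < m}) : freeRep Λ ν₀ (gr I Λ m ν₀ t) = opR Λ ν₀ t := by
  simp [freeRep, gr, opGen]

lemma freeRep_ncEval_gv (t : {t : ℕ // t + 1 < m}) (p : CPol I Λ) :
    freeRep Λ ν₀ (ncEval I Λ m ν₀ (gv I Λ m ν₀ t) p) =
      opMul Λ ν₀ (aeval ![X (fa m t), X (fb m t), 1] p) := by
  refine map_ncEval (fun i => ?_) p
  fin_cases i <;> simp [gv, freeRep_gx]

lemma freeRep_ncEval_gv3 (t : ℕ) (h2 : t + 2 < m) (p : CPol I Λ) :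
    freeRep Λ ν₀ (ncEval I Λ m ν₀ (gv3 I Λ m ν₀ t h2) p) =
      opMul Λ ν₀ (aeval ![X ⟨t, by omega⟩, X ⟨t + 1, by omega⟩, X ⟨t + 2, h2⟩] p) := by
  refine map_ncEval (fun i => ?_) p
  fin_cases i <;> simp [gv3, freeRep_gx]

lemma fracEval_Qc (h : Fin 3 → MvPolynomial (Fin m) (HRing I Λ)) {i j : I} (hij : i ≠ j)
    (u v : CPol I Λ) :
    fracEval h (Qc I Λ i j u v) = fracCoeff Λ m i j (fracEval h v - fracEval h u) *
      fracCoeff Λ m j i (fracEval h u - fracEval h v) := by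
  simp [Qc, hij, fracEval, fracCoeff, algebraMap_eq]

lemma braidData {t : ℕ} (h2 : t + 2 < m) :
    BraidData (fracCoeff Λ m)
      (permFrac (Equiv.swap (fa m ⟨t, by omega⟩) (fb m ⟨t, by omega⟩)))
      (permFrac (Equiv.swap (fa m ⟨t + 1, by omega⟩) (fb m ⟨t + 1, by omega⟩)))
      (fracX Λ m ⟨t, by omega⟩) (fracX Λ m ⟨t + 1, by omega⟩) (fracX Λ m ⟨t + 2, h2⟩) where
  ne₁₂ := fracX_ne (by simp)
  ne₁₃ := fracX_ne (by simp)
  ne₂₃ := fracX_ne (by simp)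
  s₁_x := by simp [permFrac_fracX, fa, fb]
  s₁_y := by simp [permFrac_fracX, fa, fb]
  s₁_z := by
    rw [permFrac_fracX, Equiv.swap_apply_of_ne_of_ne] <;> simp [fa, fb]
  s₂_x := by
    rw [permFrac_fracX, Equiv.swap_apply_of_ne_of_ne] <;>
      simp only [fa, fb, ne_eq, Fin.mk.injEq] <;> omega
  s₂_y := by simp [permFrac_fracX, fa, fb]
  s₂_z := by simp [permFrac_fracX, fa, fb]
  s₁_s₁ := permFrac_swap_swap _ _
  s₂_s₂ := permFrac_swap_swap _ _
  braid F := by simp only [permFrac_permFrac, ← mul_assoc, swap_fa_fb_braid h2]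
  s₁_coeff := permFrac_fracCoeff _
  s₂_coeff := permFrac_fracCoeff _

end Relations

section RelationsHold

variable {I : Type} [DecidableEq I] {Λ : I → I → Type} [∀ i j, Fintype (Λ i j)] {m : ℕ}
  {ν₀ : Fin m → I}

lemma opR_opR_of_eq {t : {t : ℕ // t + 1 < m}} {ν : Idx I m ν₀}
    (h : ν.1 (fa m t) = ν.1 (fb m t)) {g : CPol I Λ}
    (hg : (X 0 - X 1) * g =
      Pc I Λ (ν.1 (fa m t)) (X 1) (X 0) - Pc I Λ (ν.1 (fa m t)) (X 0) (X 1))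
    (f : MvPolynomial (Fin m) (HRing I Λ)) :
    opR Λ ν₀ t (opR Λ ν₀ t (Pi.single ν f)) =
      opMul Λ ν₀ (aeval ![X (fa m t), X (fb m t), 1] g) (opR Λ ν₀ t (Pi.single ν f)) := by
  simp only [opR_single, (sAct_eq_self_iff t ν).2 h, opMul_single, ← h]
  congr 1
  apply FaithfulSMul.algebraMap_injective _ (KLRFrac Λ m)
  have hg' := congrArg (fracEval ![X (fa m t), X (fb m t), 1]) hg
  simp only [map_mul, map_sub, fracEval_X, fracEval_Pc] at hg'
  simp only [map_mul, algebraMap_polIntertwiner]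
  refine intertwiner_sq_self (fracX_ne (fa_ne_fb t)) ?_ ?_ (permFrac_swap_swap _ _)
    (permFrac_fracCoeff _) hg' _ <;> simp [permFrac_fracX]

lemma opR_opR_of_ne {t : {t : ℕ // t + 1 < m}} {ν : Idx I m ν₀}
    (h : ν.1 (fa m t) ≠ ν.1 (fb m t)) (f : MvPolynomial (Fin m) (HRing I Λ)) :
    opR Λ ν₀ t (opR Λ ν₀ t (Pi.single ν f)) =
      opMul Λ ν₀ (aeval ![X (fa m t), X (fb m t), 1]
        (Qc I Λ (ν.1 (fa m t)) (ν.1 (fb m t)) (X 0) (X 1))) (Pi.single ν f) := by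
  simp only [opR_single, sAct_sAct, opMul_single, sAct_apply, Equiv.swap_apply_left,
    Equiv.swap_apply_right]
  congr 1
  apply FaithfulSMul.algebraMap_injective _ (KLRFrac Λ m)
  rw [map_mul, ← fracEval_apply, fracEval_Qc _ h]
  simp only [algebraMap_polIntertwiner, fracEval_X]
  refine intertwiner_sq_of_ne h ?_ ?_ (permFrac_swap_swap _ _)
    (permFrac_fracCoeff _) _ <;> simp [permFrac_fracX]

lemma opR_X_of_far {t : {t : ℕ // t + 1 < m}} {k : Fin m} (hk1 : k ≠ fa m t) (hk2 : k ≠ fb m t)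
    (ν : Idx I m ν₀) (f : MvPolynomial (Fin m) (HRing I Λ)) :
    opR Λ ν₀ t (opMul Λ ν₀ (X k) (Pi.single ν f)) =
      opMul Λ ν₀ (X k) (opR Λ ν₀ t (Pi.single ν f)) := by
  simp only [opR_single, opMul_single]
  congr 1
  apply FaithfulSMul.algebraMap_injective _ (KLRFrac Λ m)
  simp only [map_mul, algebraMap_polIntertwiner]
  refine intertwiner_mul_of_fixed ?_ _
  rw [permFrac_fracX, Equiv.swap_apply_of_ne_of_ne hk1 hk2]

lemma opR_X_left_of_ne {t : {t : ℕ // t + 1 < m}} {ν : Idx I m ν₀}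
    (h : ν.1 (fa m t) ≠ ν.1 (fb m t)) (f : MvPolynomial (Fin m) (HRing I Λ)) :
    opR Λ ν₀ t (opMul Λ ν₀ (X (fa m t)) (Pi.single ν f)) =
      opMul Λ ν₀ (X (fb m t)) (opR Λ ν₀ t (Pi.single ν f)) := by
  simp only [opR_single, opMul_single]
  congr 1
  apply FaithfulSMul.algebraMap_injective _ (KLRFrac Λ m)
  simp only [map_mul, algebraMap_polIntertwiner]
  refine intertwiner_mul_left_of_ne h ?_ _
  rw [permFrac_fracX, Equiv.swap_apply_left]

lemma opR_X_right_of_ne {t : {t : ℕ // t + 1 < m}} {ν : Idx I m ν₀}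
    (h : ν.1 (fa m t) ≠ ν.1 (fb m t)) (f : MvPolynomial (Fin m) (HRing I Λ)) :
    opR Λ ν₀ t (opMul Λ ν₀ (X (fb m t)) (Pi.single ν f)) =
      opMul Λ ν₀ (X (fa m t)) (opR Λ ν₀ t (Pi.single ν f)) := by
  simp only [opR_single, opMul_single]
  congr 1
  apply FaithfulSMul.algebraMap_injective _ (KLRFrac Λ m)
  simp only [map_mul, algebraMap_polIntertwiner]
  refine intertwiner_mul_right_of_ne h ?_ _
  rw [permFrac_fracX, Equiv.swap_apply_right]

lemma opR_X_left_of_eq {t : {t : ℕ // t + 1 < m}} {ν : Idx I m ν₀}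
    (h : ν.1 (fa m t) = ν.1 (fb m t)) (f : MvPolynomial (Fin m) (HRing I Λ)) :
    opR Λ ν₀ t (opMul Λ ν₀ (X (fa m t)) (Pi.single ν f)) =
      opMul Λ ν₀ (X (fb m t)) (opR Λ ν₀ t (Pi.single ν f)) -
        opMul Λ ν₀ (aeval ![X (fa m t), X (fb m t), 1]
          (Pc I Λ (ν.1 (fa m t)) (X 0) (X 1))) (Pi.single ν f) := by
  simp only [opR_single, opMul_single, (sAct_eq_self_iff t ν).2 h, ← h, ← Pi.single_sub]
  congr 1
  apply FaithfulSMul.algebraMap_injective _ (KLRFrac Λ m)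
  rw [map_sub, map_mul _ (aeval _ _), ← fracEval_apply, fracEval_Pc]
  simp only [map_mul, algebraMap_polIntertwiner, fracEval_X]
  refine intertwiner_mul_left_self (fracX_ne (fa_ne_fb t)) ?_ _
  rw [permFrac_fracX, Equiv.swap_apply_left]

lemma opR_X_right_of_eq {t : {t : ℕ // t + 1 < m}} {ν : Idx I m ν₀}
    (h : ν.1 (fa m t) = ν.1 (fb m t)) (f : MvPolynomial (Fin m) (HRing I Λ)) :
    opR Λ ν₀ t (opMul Λ ν₀ (X (fb m t)) (Pi.single ν f)) =
      opMul Λ ν₀ (X (fa m t)) (opR Λ ν₀ t (Pi.single ν f)) +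
        opMul Λ ν₀ (aeval ![X (fa m t), X (fb m t), 1]
          (Pc I Λ (ν.1 (fa m t)) (X 0) (X 1))) (Pi.single ν f) := by
  simp only [opR_single, opMul_single, (sAct_eq_self_iff t ν).2 h, ← h, ← Pi.single_add]
  congr 1
  apply FaithfulSMul.algebraMap_injective _ (KLRFrac Λ m)
  rw [map_add, map_mul _ (aeval _ _), ← fracEval_apply, fracEval_Pc]
  simp only [map_mul, algebraMap_polIntertwiner, fracEval_X]
  refine intertwiner_mul_right_self (fracX_ne (fa_ne_fb t)) ?_ _
  rw [permFrac_fracX, Equiv.swap_apply_right]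

lemma opR_comm {t s : {t : ℕ // t + 1 < m}} (h : t.1 + 1 < s.1 ∨ s.1 + 1 < t.1)
    (ν : Idx I m ν₀) (f : MvPolynomial (Fin m) (HRing I Λ)) :
    opR Λ ν₀ t (opR Λ ν₀ s (Pi.single ν f)) = opR Λ ν₀ s (opR Λ ν₀ t (Pi.single ν f)) := by
  have hne : fa m t ≠ fa m s ∧ fa m t ≠ fb m s ∧ fb m t ≠ fa m s ∧ fb m t ≠ fb m s := by
    simp only [fa, fb, ne_eq, Fin.mk.injEq]
    omega
  obtain ⟨h₁, h₂, h₃, h₄⟩ := hne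
  simp only [opR_single, sAct_comm h, sAct_apply, Equiv.swap_apply_of_ne_of_ne h₁ h₂,
    Equiv.swap_apply_of_ne_of_ne h₃ h₄, Equiv.swap_apply_of_ne_of_ne h₁.symm h₃.symm,
    Equiv.swap_apply_of_ne_of_ne h₂.symm h₄.symm]
  congr 1
  apply FaithfulSMul.algebraMap_injective _ (KLRFrac Λ m)
  simp only [algebraMap_polIntertwiner]
  refine intertwiner_comm (fun F => ?_) ?_ ?_ ?_ ?_ (permFrac_fracCoeff _) (permFrac_fracCoeff _) _
  · simp only [permFrac_permFrac, swap_far h]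
  all_goals rw [permFrac_fracX, Equiv.swap_apply_of_ne_of_ne]
  all_goals first | assumption | (apply Ne.symm; assumption)

section Braid

variable {t : ℕ} {h2 : t + 2 < m} {ν : Idx I m ν₀}

lemma opR_opR_opR_single_left (f : MvPolynomial (Fin m) (HRing I Λ)) :
    opR Λ ν₀ ⟨t + 1, by omega⟩ (opR Λ ν₀ ⟨t, by omega⟩ (opR Λ ν₀ ⟨t + 1, by omega⟩
        (Pi.single ν f))) =
      Pi.single (sAct I m ν₀ ⟨t, by omega⟩ (sAct I m ν₀ ⟨t + 1, by omega⟩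
        (sAct I m ν₀ ⟨t, by omega⟩ ν)))
        (polIntertwiner Λ ν₀ ⟨t + 1, by omega⟩ (ν.1 ⟨t, by omega⟩) (ν.1 ⟨t + 1, by omega⟩)
          (polIntertwiner Λ ν₀ ⟨t, by omega⟩ (ν.1 ⟨t, by omega⟩) (ν.1 ⟨t + 2, h2⟩)
            (polIntertwiner Λ ν₀ ⟨t + 1, by omega⟩ (ν.1 ⟨t + 1, by omega⟩)
              (ν.1 ⟨t + 2, h2⟩) f))) := by
  simp only [opR_single, sAct_braid h2]
  have e : t ≠ t + 1 + 1 := by omega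
  simp [sAct_apply, fa, fb, Equiv.swap_apply_def, e, e.symm]

lemma opR_opR_opR_single_right (f : MvPolynomial (Fin m) (HRing I Λ)) :
    opR Λ ν₀ ⟨t, by omega⟩ (opR Λ ν₀ ⟨t + 1, by omega⟩ (opR Λ ν₀ ⟨t, by omega⟩
        (Pi.single ν f))) =
      Pi.single (sAct I m ν₀ ⟨t, by omega⟩ (sAct I m ν₀ ⟨t + 1, by omega⟩
        (sAct I m ν₀ ⟨t, by omega⟩ ν)))
        (polIntertwiner Λ ν₀ ⟨t, by omega⟩ (ν.1 ⟨t + 1, by omega⟩) (ν.1 ⟨t + 2, h2⟩)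
          (polIntertwiner Λ ν₀ ⟨t + 1, by omega⟩ (ν.1 ⟨t, by omega⟩) (ν.1 ⟨t + 2, h2⟩)
            (polIntertwiner Λ ν₀ ⟨t, by omega⟩ (ν.1 ⟨t, by omega⟩)
              (ν.1 ⟨t + 1, by omega⟩) f))) := by
  simp only [opR_single]
  have e : t ≠ t + 1 + 1 := by omega
  simp [sAct_apply, fa, fb, Equiv.swap_apply_def, e, e.symm]

lemma opR_braid_of_ne (h : ν.1 ⟨t, by omega⟩ ≠ ν.1 ⟨t + 2, h2⟩)
    (f : MvPolynomial (Fin m) (HRing I Λ)) :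
    opR Λ ν₀ ⟨t + 1, by omega⟩ (opR Λ ν₀ ⟨t, by omega⟩ (opR Λ ν₀ ⟨t + 1, by omega⟩
        (Pi.single ν f))) =
      opR Λ ν₀ ⟨t, by omega⟩ (opR Λ ν₀ ⟨t + 1, by omega⟩ (opR Λ ν₀ ⟨t, by omega⟩
        (Pi.single ν f))) := by
  rw [opR_opR_opR_single_left (h2 := h2), opR_opR_opR_single_right (h2 := h2)]
  congr 1
  apply FaithfulSMul.algebraMap_injective _ (KLRFrac Λ m)
  simp only [algebraMap_polIntertwiner]
  exact (braidData h2).intertwiner_braid_of_ne h _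

lemma opR_braid_of_eq_of_ne (hac : ν.1 ⟨t, by omega⟩ = ν.1 ⟨t + 2, h2⟩)
    (hab : ν.1 ⟨t, by omega⟩ ≠ ν.1 ⟨t + 1, by omega⟩) {q : CPol I Λ}
    (hq : (X 0 - X 2) * q =
      Qc I Λ (ν.1 ⟨t, by omega⟩) (ν.1 ⟨t + 1, by omega⟩) (X 0) (X 1)
        - Qc I Λ (ν.1 ⟨t, by omega⟩) (ν.1 ⟨t + 1, by omega⟩) (X 2) (X 1))
    (f : MvPolynomial (Fin m) (HRing I Λ)) :
    opR Λ ν₀ ⟨t + 1, by omega⟩ (opR Λ ν₀ ⟨t, by omega⟩ (opR Λ ν₀ ⟨t + 1, by omega⟩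
        (Pi.single ν f))) =
      opR Λ ν₀ ⟨t, by omega⟩ (opR Λ ν₀ ⟨t + 1, by omega⟩ (opR Λ ν₀ ⟨t, by omega⟩
        (Pi.single ν f))) +
      opMul Λ ν₀ (aeval ![X ⟨t, by omega⟩, X ⟨t + 1, by omega⟩, X ⟨t + 2, h2⟩]
        (Pc I Λ (ν.1 ⟨t, by omega⟩) (X 0) (X 2) * q)) (Pi.single ν f) := by
  have hν : sAct I m ν₀ ⟨t, by omega⟩ (sAct I m ν₀ ⟨t + 1, by omega⟩
      (sAct I m ν₀ ⟨t, by omega⟩ ν)) = ν := by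
    have : sAct I m ν₀ ⟨t + 1, by omega⟩ (sAct I m ν₀ ⟨t, by omega⟩ ν) =
        sAct I m ν₀ ⟨t, by omega⟩ ν := by
      rw [sAct_eq_self_iff]
      have e : t ≠ t + 1 + 1 := by omega
      simpa [sAct_apply, fa, fb, Equiv.swap_apply_def, e, e.symm] using hac
    rw [this, sAct_sAct]
  rw [opR_opR_opR_single_left (h2 := h2), opR_opR_opR_single_right (h2 := h2), opMul_single, hν,
    ← hac, ← Pi.single_add]
  congr 1
  apply FaithfulSMul.algebraMap_injective _ (KLRFrac Λ m)
  have hq' := congrArg (fracEval ![X ⟨t, by omega⟩, X ⟨t + 1, by omega⟩, X ⟨t + 2, h2⟩]) hq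
  simp only [map_mul, map_sub, fracEval_X, fracEval_Qc _ hab] at hq'
  rw [map_add, map_mul _ (aeval _ _), ← fracEval_apply, map_mul, fracEval_Pc]
  simp only [algebraMap_polIntertwiner, fracEval_X]
  exact (braidData h2).intertwiner_braid_of_eq_of_ne hab hq' _

lemma opR_braid_of_eq (hab : ν.1 ⟨t, by omega⟩ = ν.1 ⟨t + 1, by omega⟩)
    (hbc : ν.1 ⟨t + 1, by omega⟩ = ν.1 ⟨t + 2, h2⟩) {p p' : CPol I Λ}
    (hp : ((X 0 - X 1) * ((X 0 - X 2) * (X 1 - X 2))) * p =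
      Pc I Λ (ν.1 ⟨t, by omega⟩) (X 1) (X 0) * Pc I Λ (ν.1 ⟨t, by omega⟩) (X 0) (X 2) *
          (X 1 - X 2)
        + Pc I Λ (ν.1 ⟨t, by omega⟩) (X 0) (X 2) * Pc I Λ (ν.1 ⟨t, by omega⟩) (X 1) (X 2) *
          (X 0 - X 1)
        - Pc I Λ (ν.1 ⟨t, by omega⟩) (X 0) (X 1) * Pc I Λ (ν.1 ⟨t, by omega⟩) (X 1) (X 2) *
          (X 0 - X 2))
    (hp' : ((X 0 - X 1) * ((X 0 - X 2) * (X 1 - X 2))) * p' =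
      -(Pc I Λ (ν.1 ⟨t, by omega⟩) (X 0) (X 1) * Pc I Λ (ν.1 ⟨t, by omega⟩) (X 0) (X 2) *
          (X 1 - X 2))
        - Pc I Λ (ν.1 ⟨t, by omega⟩) (X 0) (X 2) * Pc I Λ (ν.1 ⟨t, by omega⟩) (X 2) (X 1) *
          (X 0 - X 1)
        + Pc I Λ (ν.1 ⟨t, by omega⟩) (X 0) (X 1) * Pc I Λ (ν.1 ⟨t, by omega⟩) (X 1) (X 2) *
          (X 0 - X 2))
    (f : MvPolynomial (Fin m) (HRing I Λ)) :
    opR Λ ν₀ ⟨t + 1, by omega⟩ (opR Λ ν₀ ⟨t, by omega⟩ (opR Λ ν₀ ⟨t + 1, by omega⟩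
        (Pi.single ν f))) =
      opR Λ ν₀ ⟨t, by omega⟩ (opR Λ ν₀ ⟨t + 1, by omega⟩ (opR Λ ν₀ ⟨t, by omega⟩
        (Pi.single ν f))) +
      opMul Λ ν₀ (aeval ![X ⟨t, by omega⟩, X ⟨t + 1, by omega⟩, X ⟨t + 2, h2⟩] p)
        (opR Λ ν₀ ⟨t, by omega⟩ (Pi.single ν f)) +
      opMul Λ ν₀ (aeval ![X ⟨t, by omega⟩, X ⟨t + 1, by omega⟩, X ⟨t + 2, h2⟩] p')
        (opR Λ ν₀ ⟨t + 1, by omega⟩ (Pi.single ν f)) := by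
  have hν : sAct I m ν₀ ⟨t, by omega⟩ ν = ν := (sAct_eq_self_iff _ _).2 hab
  have hν' : sAct I m ν₀ ⟨t + 1, by omega⟩ ν = ν := (sAct_eq_self_iff _ _).2 hbc
  simp only [opR_single, hν, hν', opMul_single, ← Pi.single_add, fa, fb, ← hbc, ← hab]
  congr 1
  apply FaithfulSMul.algebraMap_injective _ (KLRFrac Λ m)
  have hq := congrArg (fracEval ![X ⟨t, by omega⟩, X ⟨t + 1, by omega⟩, X ⟨t + 2, h2⟩]) hp
  have hq' := congrArg (fracEval ![X ⟨t, by omega⟩, X ⟨t + 1, by omega⟩, X ⟨t + 2, h2⟩]) hp'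
  simp only [map_mul, map_sub, map_add, map_neg, fracEval_X, fracEval_Pc] at hq hq'
  simp only [map_add, map_mul, algebraMap_polIntertwiner]
  exact (braidData h2).intertwiner_braid_of_eq hq hq' _

end Braid

set_option linter.unusedSimpArgs false in
lemma freeRep_rel {a b : KLRFree I Λ m ν₀} (h : KLRRel I Λ m ν₀ a b) :
    freeRep Λ ν₀ a = freeRep Λ ν₀ b := by
  cases h with
  | e_orth ν ν' h =>
    refine end_ext_of_component ν' (fun μ hμ f => ?_) (fun f => ?_) <;>
    simp [freeRep_ge, opE_single_of_ne, opE_single_self, *]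
  | e_idem ν =>
    refine end_ext_of_component ν (fun μ hμ f => ?_) (fun f => ?_) <;>
    simp [freeRep_ge, opE_single_of_ne, opE_single_self, *]
  | e_sum =>
    refine LinearMap.pi_ext fun μ f => ?_
    rw [map_sum, map_one, LinearMap.sum_apply, Finset.sum_eq_single μ]
    · simp [freeRep_ge, opE_single_self]
    · intro ν _ hν
      rw [freeRep_ge, opE_single_of_ne hν]
    · simp
  | x_e k ν =>
    refine end_ext_of_component ν (fun μ hμ f => ?_) (fun f => ?_) <;>
    simp [freeRep_ge, freeRep_gx, opE_single_of_ne, opE_single_self, opMul_single, *]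
  | x_x k l => rw [map_mul, map_mul, freeRep_gx, freeRep_gx, ← map_mul, mul_comm, map_mul]
  | r_e t ν =>
    refine end_ext_of_component ν (fun μ hμ f => ?_) (fun f => ?_)
    · have : sAct I m ν₀ t ν ≠ sAct I m ν₀ t μ := fun h =>
        hμ (by rw [← sAct_sAct t ν, h, sAct_sAct])
      simp [freeRep_ge, freeRep_gr, opE_single_of_ne, opR_single, *]
    · simp [freeRep_ge, freeRep_gr, opE_single_self, opR_single]
  | r_r_far t s h =>
    refine LinearMap.pi_ext fun μ f => ?_
    simp only [map_mul, freeRep_gr, Module.End.mul_apply, opR_comm h]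
  | rr_eq t ν h g hg =>
    refine end_ext_of_component ν (fun μ hμ f => ?_) (fun f => ?_)
    · simp [freeRep_ge, opE_single_of_ne hμ]
    · simp only [map_mul (freeRep Λ ν₀), map_add (freeRep Λ ν₀), map_sub (freeRep Λ ν₀),
        freeRep_ge, freeRep_gr, freeRep_gx, freeRep_ncEval_gv, freeRep_ncEval_gv3,
        LinearMap.add_apply, LinearMap.sub_apply, Module.End.mul_apply, opE_single_self]
      exact opR_opR_of_eq h hg f
  | rr_ne t ν h =>
    refine end_ext_of_component ν (fun μ hμ f => ?_) (fun f => ?_)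
    · simp [freeRep_ge, opE_single_of_ne hμ]
    · simp only [map_mul (freeRep Λ ν₀), map_add (freeRep Λ ν₀), map_sub (freeRep Λ ν₀),
        freeRep_ge, freeRep_gr, freeRep_gx, freeRep_ncEval_gv, freeRep_ncEval_gv3,
        LinearMap.add_apply, LinearMap.sub_apply, Module.End.mul_apply, opE_single_self]
      exact opR_opR_of_ne h f
  | r_x_far t k hk1 hk2 ν =>
    refine end_ext_of_component ν (fun μ hμ f => ?_) (fun f => ?_)
    · simp [freeRep_ge, opE_single_of_ne hμ]
    · simp only [map_mul (freeRep Λ ν₀), map_add (freeRep Λ ν₀), map_sub (freeRep Λ ν₀),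
        freeRep_ge, freeRep_gr, freeRep_gx, freeRep_ncEval_gv, freeRep_ncEval_gv3,
        LinearMap.add_apply, LinearMap.sub_apply, Module.End.mul_apply, opE_single_self]
      exact opR_X_of_far hk1 hk2 ν f
  | r_x_t_ne t ν h =>
    refine end_ext_of_component ν (fun μ hμ f => ?_) (fun f => ?_)
    · simp [freeRep_ge, opE_single_of_ne hμ]
    · simp only [map_mul (freeRep Λ ν₀), map_add (freeRep Λ ν₀), map_sub (freeRep Λ ν₀),
        freeRep_ge, freeRep_gr, freeRep_gx, freeRep_ncEval_gv, freeRep_ncEval_gv3,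
        LinearMap.add_apply, LinearMap.sub_apply, Module.End.mul_apply, opE_single_self]
      exact opR_X_left_of_ne h f
  | r_x_t1_ne t ν h =>
    refine end_ext_of_component ν (fun μ hμ f => ?_) (fun f => ?_)
    · simp [freeRep_ge, opE_single_of_ne hμ]
    · simp only [map_mul (freeRep Λ ν₀), map_add (freeRep Λ ν₀), map_sub (freeRep Λ ν₀),
        freeRep_ge, freeRep_gr, freeRep_gx, freeRep_ncEval_gv, freeRep_ncEval_gv3,
        LinearMap.add_apply, LinearMap.sub_apply, Module.End.mul_apply, opE_single_self]
      exact opR_X_right_of_ne h f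
  | r_x_t_eq t ν h =>
    refine end_ext_of_component ν (fun μ hμ f => ?_) (fun f => ?_)
    · simp [freeRep_ge, opE_single_of_ne hμ]
    · simp only [map_mul (freeRep Λ ν₀), map_add (freeRep Λ ν₀), map_sub (freeRep Λ ν₀),
        freeRep_ge, freeRep_gr, freeRep_gx, freeRep_ncEval_gv, freeRep_ncEval_gv3,
        LinearMap.add_apply, LinearMap.sub_apply, Module.End.mul_apply, opE_single_self]
      exact opR_X_left_of_eq h f
  | r_x_t1_eq t ν h =>
    refine end_ext_of_component ν (fun μ hμ f => ?_) (fun f => ?_)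
    · simp [freeRep_ge, opE_single_of_ne hμ]
    · simp only [map_mul (freeRep Λ ν₀), map_add (freeRep Λ ν₀), map_sub (freeRep Λ ν₀),
        freeRep_ge, freeRep_gr, freeRep_gx, freeRep_ncEval_gv, freeRep_ncEval_gv3,
        LinearMap.add_apply, LinearMap.sub_apply, Module.End.mul_apply, opE_single_self]
      exact opR_X_right_of_eq h f
  | braid_far t h2 ν h =>
    refine end_ext_of_component ν (fun μ hμ f => ?_) (fun f => ?_)
    · simp [freeRep_ge, opE_single_of_ne hμ]
    · simp only [map_mul (freeRep Λ ν₀), map_add (freeRep Λ ν₀), map_sub (freeRep Λ ν₀),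
        freeRep_ge, freeRep_gr, freeRep_gx, freeRep_ncEval_gv, freeRep_ncEval_gv3,
        LinearMap.add_apply, LinearMap.sub_apply, Module.End.mul_apply, opE_single_self]
      exact opR_braid_of_ne h f
  | braid_Q t h2 ν hac hab q hq =>
    refine end_ext_of_component ν (fun μ hμ f => ?_) (fun f => ?_)
    · simp [freeRep_ge, opE_single_of_ne hμ]
    · simp only [map_mul (freeRep Λ ν₀), map_add (freeRep Λ ν₀), map_sub (freeRep Λ ν₀),
        freeRep_ge, freeRep_gr, freeRep_gx, freeRep_ncEval_gv, freeRep_ncEval_gv3,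
        LinearMap.add_apply, LinearMap.sub_apply, Module.End.mul_apply, opE_single_self]
      exact opR_braid_of_eq_of_ne hac hab hq f
  | braid_P t h2 ν hab hbc p p' hp hp' =>
    refine end_ext_of_component ν (fun μ hμ f => ?_) (fun f => ?_)
    · simp [freeRep_ge, opE_single_of_ne hμ]
    · simp only [map_mul (freeRep Λ ν₀), map_add (freeRep Λ ν₀), map_sub (freeRep Λ ν₀),
        freeRep_ge, freeRep_gr, freeRep_gx, freeRep_ncEval_gv, freeRep_ncEval_gv3,
        LinearMap.add_apply, LinearMap.sub_apply, Module.End.mul_apply, opE_single_self]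
      exact opR_braid_of_eq hab hbc hp hp' f

end RelationsHold

section Divisibility

variable {σ H : Type*} [DecidableEq σ] [CommRing H]

lemma X_sub_X_dvd_of_aeval_update {a b : σ} {F : MvPolynomial σ H}
    (h : aeval (Function.update X a (X b)) F = (0 : MvPolynomial σ H)) : X a - X b ∣ F := by
  rw [← Ideal.mem_span_singleton, ← Ideal.Quotient.eq_zero_iff_mem]
  have key : (Ideal.Quotient.mkₐ H (Ideal.span {(X a - X b : MvPolynomial σ H)})).comp
      (aeval (Function.update X a (X b))) = Ideal.Quotient.mkₐ H _ := by
    ext k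
    rcases eq_or_ne k a with rfl | hk
    · simp only [AlgHom.comp_apply, aeval_X, Function.update_self, Ideal.Quotient.mkₐ_eq_mk]
      rw [eq_comm, Ideal.Quotient.eq]
      exact Ideal.mem_span_singleton_self _
    · simp [hk]
  have := DFunLike.congr_fun key F
  rw [AlgHom.comp_apply, h, map_zero] at this
  exact this.symm

variable [IsDomain H]

lemma vandermonde_dvd_of_aeval_update {a b c : σ} (hab : a ≠ b) (hac : a ≠ c) (hbc : b ≠ c)
    {F : MvPolynomial σ H}
    (h₁ : aeval (Function.update X a (X b)) F = (0 : MvPolynomial σ H))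
    (h₂ : aeval (Function.update X a (X c)) F = (0 : MvPolynomial σ H))
    (h₃ : aeval (Function.update X b (X c)) F = (0 : MvPolynomial σ H)) :
    (X a - X b) * ((X a - X c) * (X b - X c)) ∣ F := by
  obtain ⟨G, rfl⟩ := X_sub_X_dvd_of_aeval_update h₁
  have hG : aeval (Function.update X a (X c)) G = (0 : MvPolynomial σ H) := by
    simpa [hab.symm, X_sub_X_ne_zero hbc.symm] using h₂
  obtain ⟨K, rfl⟩ := X_sub_X_dvd_of_aeval_update hG
  have hK : aeval (Function.update X b (X c)) K = (0 : MvPolynomial σ H) := by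
    simpa [hab, hbc.symm, X_sub_X_ne_zero hac] using h₃
  obtain ⟨L, rfl⟩ := X_sub_X_dvd_of_aeval_update hK
  exact ⟨L, by ring⟩

end Divisibility

section CoefficientQuotients

variable {I : Type} {Λ : I → I → Type} [∀ i j, Fintype (Λ i j)]

lemma bind₁_Pc (h : Fin 3 → CPol I Λ) (i : I) (u v : CPol I Λ) :
    bind₁ h (Pc I Λ i u v) = Pc I Λ i (bind₁ h u) (bind₁ h v) := by
  simp [Pc]

lemma bind₁_Qc [DecidableEq I] (h : Fin 3 → CPol I Λ) (i j : I) (u v : CPol I Λ) :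
    bind₁ h (Qc I Λ i j u v) = Qc I Λ i j (bind₁ h u) (bind₁ h v) := by
  unfold Qc
  split_ifs <;> simp

lemma exists_dividedDiff_Pc (i : I) : ∃ g : CPol I Λ,
    (X 0 - X 1) * g = Pc I Λ i (X 1) (X 0) - Pc I Λ i (X 0) (X 1) := by
  have : (X 0 - X 1 : CPol I Λ) ∣ Pc I Λ i (X 1) (X 0) - Pc I Λ i (X 0) (X 1) :=
    X_sub_X_dvd_of_aeval_update (by simp [bind₁_Pc])
  exact this.imp fun _ => Eq.symm

lemma exists_dividedDiff_Qc [DecidableEq I] (i j : I) : ∃ q : CPol I Λ,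
    (X 0 - X 2) * q = Qc I Λ i j (X 0) (X 1) - Qc I Λ i j (X 2) (X 1) := by
  have : (X 0 - X 2 : CPol I Λ) ∣ Qc I Λ i j (X 0) (X 1) - Qc I Λ i j (X 2) (X 1) :=
    X_sub_X_dvd_of_aeval_update (by simp [bind₁_Qc])
  exact this.imp fun _ => Eq.symm

lemma exists_braid_coeff_left (i : I) : ∃ p : CPol I Λ,
    ((X 0 - X 1) * ((X 0 - X 2) * (X 1 - X 2))) * p =
      Pc I Λ i (X 1) (X 0) * Pc I Λ i (X 0) (X 2) * (X 1 - X 2)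
        + Pc I Λ i (X 0) (X 2) * Pc I Λ i (X 1) (X 2) * (X 0 - X 1)
        - Pc I Λ i (X 0) (X 1) * Pc I Λ i (X 1) (X 2) * (X 0 - X 2) := by
  suffices (X 0 - X 1 : CPol I Λ) * ((X 0 - X 2) * (X 1 - X 2)) ∣ _ from
    this.imp fun _ => Eq.symm
  refine vandermonde_dvd_of_aeval_update (by decide) (by decide) (by decide) ?_ ?_ ?_ <;>
  · simp [bind₁_Pc]
    try ring

lemma exists_braid_coeff_right (i : I) : ∃ p : CPol I Λ,
    ((X 0 - X 1) * ((X 0 - X 2) * (X 1 - X 2))) * p =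
      -(Pc I Λ i (X 0) (X 1) * Pc I Λ i (X 0) (X 2) * (X 1 - X 2))
        - Pc I Λ i (X 0) (X 2) * Pc I Λ i (X 2) (X 1) * (X 0 - X 1)
        + Pc I Λ i (X 0) (X 1) * Pc I Λ i (X 1) (X 2) * (X 0 - X 2) := by
  suffices (X 0 - X 1 : CPol I Λ) * ((X 0 - X 2) * (X 1 - X 2)) ∣ _ from
    this.imp fun _ => Eq.symm
  refine vandermonde_dvd_of_aeval_update (by decide) (by decide) (by decide) ?_ ?_ ?_ <;>
  · simp [bind₁_Pc]
    try ring

end CoefficientQuotients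

section Generators

variable {I : Type} [DecidableEq I] {Λ : I → I → Type} [∀ i j, Fintype (Λ i j)] {m : ℕ}
  {ν₀ : Fin m → I}

variable (Λ) in
/-- The idempotent `e(ν)` of `R(α)`. -/
noncomputable def klrE (ν : Idx I m ν₀) : KLRAlg I Λ m ν₀ :=
  klrMk I Λ m ν₀ (ge I Λ m ν₀ ν)

variable (Λ ν₀) in
/-- The element `x_k` of `R(α)`. -/
noncomputable def klrX (k : Fin m) : KLRAlg I Λ m ν₀ :=
  klrMk I Λ m ν₀ (gx I Λ m ν₀ k)

variable (Λ ν₀) in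
/-- The element `r_t` of `R(α)`, extended by zero to all natural numbers `t`. -/
noncomputable def klrR (t : ℕ) : KLRAlg I Λ m ν₀ :=
  if h : t + 1 < m then klrMk I Λ m ν₀ (gr I Λ m ν₀ ⟨t, h⟩) else 0

lemma klrMk_gr (t : {t : ℕ // t + 1 < m}) :
    klrMk I Λ m ν₀ (gr I Λ m ν₀ t) = klrR Λ ν₀ t.1 := by
  rw [klrR, dif_pos t.2]

lemma klrMk_ge (ν : Idx I m ν₀) : klrMk I Λ m ν₀ (ge I Λ m ν₀ ν) = klrE Λ ν :=
  rfl

lemma klrMk_gx (k : Fin m) : klrMk I Λ m ν₀ (gx I Λ m ν₀ k) = klrX Λ ν₀ k :=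
  rfl

lemma klrR_of_not_lt {t : ℕ} (h : ¬ t + 1 < m) : klrR Λ ν₀ t = 0 :=
  dif_neg h

lemma klrMk_eq {a b : KLRFree I Λ m ν₀} (h : KLRRel I Λ m ν₀ a b) :
    klrMk I Λ m ν₀ a = klrMk I Λ m ν₀ b :=
  RingQuot.mkAlgHom_rel _ h

lemma klrMk_sub (a b : KLRFree I Λ m ν₀) :
    klrMk I Λ m ν₀ (a - b) =
      klrMk I Λ m ν₀ a + algebraMap (HRing I Λ) _ (-1) * klrMk I Λ m ν₀ b := by
  have h : a - b = a + algebraMap (HRing I Λ) _ (-1) * b := by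
    rw [map_neg, map_one, sub_eq_add_neg]
    exact congrArg (a + ·) (neg_one_mul b).symm
  rw [h, map_add, map_mul, AlgHom.commutes]

lemma klrMk_surjective : Function.Surjective (klrMk I Λ m ν₀) :=
  RingQuot.mkAlgHom_surjective _ _

lemma sum_klrE : ∑ ν : Idx I m ν₀, klrE Λ ν = 1 := by
  have := klrMk_eq (KLRRel.e_sum (Λ := Λ) (ν₀ := ν₀))
  rwa [map_sum, map_one] at this

lemma klrE_mul_self (ν : Idx I m ν₀) : klrE Λ ν * klrE Λ ν = klrE Λ ν := by
  simpa only [map_mul, klrMk_ge, klrMk_gx] using klrMk_eq (KLRRel.e_idem (Λ := Λ) ν)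

lemma klrE_mul_klrE_of_ne {ν μ : Idx I m ν₀} (h : ν ≠ μ) : klrE Λ ν * klrE Λ μ = 0 := by
  simpa only [map_mul, map_zero, klrMk_ge] using klrMk_eq (KLRRel.e_orth (Λ := Λ) ν μ h)

lemma klrX_mul_klrE (k : Fin m) (ν : Idx I m ν₀) :
    klrX Λ ν₀ k * klrE Λ ν = klrE Λ ν * klrX Λ ν₀ k := by
  simpa only [map_mul, klrMk_ge, klrMk_gx] using klrMk_eq (KLRRel.x_e (Λ := Λ) k ν)

lemma klrX_mul_klrX (k l : Fin m) :
    klrX Λ ν₀ k * klrX Λ ν₀ l = klrX Λ ν₀ l * klrX Λ ν₀ k := by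
  simpa only [map_mul, klrMk_ge, klrMk_gx] using klrMk_eq (KLRRel.x_x (Λ := Λ) (ν₀ := ν₀) k l)

lemma klrR_mul_klrE (t : {t : ℕ // t + 1 < m}) (ν : Idx I m ν₀) :
    klrR Λ ν₀ t.1 * klrE Λ ν = klrE Λ (sAct I m ν₀ t ν) * klrR Λ ν₀ t.1 := by
  simpa only [map_mul, klrMk_gr, klrMk_ge] using klrMk_eq (KLRRel.r_e (Λ := Λ) t ν)

lemma klrR_mul_klrR_far {t s : ℕ} (h : s + 1 < t) :
    klrR Λ ν₀ t * klrR Λ ν₀ s = klrR Λ ν₀ s * klrR Λ ν₀ t := by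
  by_cases ht : t + 1 < m
  · simpa only [map_mul, klrMk_gr] using
      klrMk_eq (KLRRel.r_r_far (Λ := Λ) (ν₀ := ν₀) ⟨t, ht⟩ ⟨s, by omega⟩ (Or.inr h))
  · simp [klrR_of_not_lt ht]

lemma mem_of_mul_klrE {M : Submodule (HRing I Λ) (KLRAlg I Λ m ν₀)} {b : KLRAlg I Λ m ν₀}
    (h : ∀ ν, b * klrE Λ ν ∈ M) : b ∈ M := by
  rw [← mul_one b, ← sum_klrE, Finset.mul_sum]
  exact Submodule.sum_mem _ fun ν _ => h ν

variable (Λ ν₀) in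
/-- The subalgebra of `R(α)` generated by the idempotents and the polynomial generators. -/
noncomputable def klrCoeff : Subalgebra (HRing I Λ) (KLRAlg I Λ m ν₀) :=
  Algebra.adjoin _ (Set.range (klrX Λ ν₀) ∪ Set.range (klrE Λ))

lemma klrX_mem (k : Fin m) : klrX Λ ν₀ k ∈ klrCoeff Λ ν₀ :=
  Algebra.subset_adjoin (Or.inl ⟨k, rfl⟩)

lemma klrE_mem (ν : Idx I m ν₀) : klrE Λ ν ∈ klrCoeff Λ ν₀ :=
  Algebra.subset_adjoin (Or.inr ⟨ν, rfl⟩)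

lemma klrMk_ncEval_mem {g : Fin 3 → KLRFree I Λ m ν₀}
    (hg : ∀ i, klrMk I Λ m ν₀ (g i) ∈ klrCoeff Λ ν₀) (p : CPol I Λ) :
    klrMk I Λ m ν₀ (ncEval I Λ m ν₀ g p) ∈ klrCoeff Λ ν₀ := by
  rw [ncEval, map_sum]
  refine sum_mem fun s _ => ?_
  simp only [map_mul, map_pow, AlgHom.commutes]
  exact mul_mem (algebraMap_mem _ _) (mul_mem (pow_mem (hg 0) _)
    (mul_mem (pow_mem (hg 1) _) (pow_mem (hg 2) _)))

lemma klrMk_ncEval_gv_mem (t : {t : ℕ // t + 1 < m}) (p : CPol I Λ) :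
    klrMk I Λ m ν₀ (ncEval I Λ m ν₀ (gv I Λ m ν₀ t) p) ∈ klrCoeff Λ ν₀ := by
  refine klrMk_ncEval_mem (fun i => ?_) p
  fin_cases i
  · exact klrX_mem _
  · exact klrX_mem _
  · simp [gv]

lemma klrMk_ncEval_gv3_mem (t : ℕ) (h2 : t + 2 < m) (p : CPol I Λ) :
    klrMk I Λ m ν₀ (ncEval I Λ m ν₀ (gv3 I Λ m ν₀ t h2) p) ∈ klrCoeff Λ ν₀ := by
  refine klrMk_ncEval_mem (fun i => ?_) p
  fin_cases i <;> exact klrX_mem _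

/-- The submodule `A r_t + A`, where `A` is the coefficient subalgebra. -/
lemma mem_klrCoeff_mul_span_add {r b : KLRAlg I Λ m ν₀} :
    b ∈ (klrCoeff Λ ν₀).toSubmodule * Submodule.span (HRing I Λ) {r}
        + (klrCoeff Λ ν₀).toSubmodule ↔
      ∃ a₁ ∈ klrCoeff Λ ν₀, ∃ a₂ ∈ klrCoeff Λ ν₀, a₁ * r + a₂ = b := by
  simp only [Submodule.add_eq_sup, Submodule.mem_sup, Submodule.mem_mul_span_singleton,
    Subalgebra.mem_toSubmodule]
  constructor
  · rintro ⟨_, ⟨a₁, h₁, rfl⟩, a₂, h₂, rfl⟩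
    exact ⟨a₁, h₁, a₂, h₂, rfl⟩
  · rintro ⟨a₁, h₁, a₂, h₂, rfl⟩
    exact ⟨_, ⟨a₁, h₁, rfl⟩, a₂, h₂, rfl⟩

end Generators

section Spanning

variable {I : Type} [DecidableEq I] {Λ : I → I → Type} [∀ i j, Fintype (Λ i j)] {m : ℕ}
  {ν₀ : Fin m → I}

lemma klrR_mul_klrX_mem (t : {t : ℕ // t + 1 < m}) (k : Fin m) :
    klrR Λ ν₀ t.1 * klrX Λ ν₀ k ∈
      (klrCoeff Λ ν₀).toSubmodule * Submodule.span (HRing I Λ) {klrR Λ ν₀ t.1}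
        + (klrCoeff Λ ν₀).toSubmodule := by
  refine mem_of_mul_klrE fun ν => mem_klrCoeff_mul_span_add.2 ?_
  have he := klrR_mul_klrE (Λ := Λ) t ν
  have hmem (l : Fin m) : klrX Λ ν₀ l * klrE Λ (sAct I m ν₀ t ν) ∈ klrCoeff Λ ν₀ :=
    mul_mem (klrX_mem _) (klrE_mem _)
  have hP := mul_mem (klrMk_ncEval_gv_mem (Λ := Λ) (ν₀ := ν₀) t
    (Pc I Λ (ν.1 (fa m t)) (X 0) (X 1))) (klrE_mem ν)
  by_cases h : ν.1 (fa m t) = ν.1 (fb m t)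
  · rcases eq_or_ne k (fa m t) with rfl | ha
    · refine ⟨_, hmem (fb m t), _, mul_mem (algebraMap_mem _ (-1)) hP, ?_⟩
      have := klrMk_eq (KLRRel.r_x_t_eq (Λ := Λ) t ν h)
      simp only [klrMk_sub, map_mul, klrMk_gr, klrMk_ge, klrMk_gx] at this
      rw [mul_assoc, ← he]
      exact this.symm
    rcases eq_or_ne k (fb m t) with rfl | hb
    · refine ⟨_, hmem (fa m t), _, hP, ?_⟩
      have := klrMk_eq (KLRRel.r_x_t1_eq (Λ := Λ) t ν h)
      simp only [map_mul, map_add, klrMk_gr, klrMk_ge, klrMk_gx] at this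
      rw [mul_assoc, ← he]
      exact this.symm
    · refine ⟨_, hmem k, 0, zero_mem _, ?_⟩
      have := klrMk_eq (KLRRel.r_x_far (Λ := Λ) t k ha hb ν)
      simp only [map_mul, klrMk_gr, klrMk_ge] at this
      rw [mul_assoc, ← he, add_zero]
      exact this.symm
  · rcases eq_or_ne k (fa m t) with rfl | ha
    · refine ⟨_, hmem (fb m t), 0, zero_mem _, ?_⟩
      have := klrMk_eq (KLRRel.r_x_t_ne (Λ := Λ) t ν h)
      simp only [map_mul, klrMk_gr, klrMk_ge] at this
      rw [mul_assoc, ← he, add_zero]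
      exact this.symm
    rcases eq_or_ne k (fb m t) with rfl | hb
    · refine ⟨_, hmem (fa m t), 0, zero_mem _, ?_⟩
      have := klrMk_eq (KLRRel.r_x_t1_ne (Λ := Λ) t ν h)
      simp only [map_mul, klrMk_gr, klrMk_ge] at this
      rw [mul_assoc, ← he, add_zero]
      exact this.symm
    · refine ⟨_, hmem k, 0, zero_mem _, ?_⟩
      have := klrMk_eq (KLRRel.r_x_far (Λ := Λ) t k ha hb ν)
      simp only [map_mul, klrMk_gr, klrMk_ge] at this
      rw [mul_assoc, ← he, add_zero]
      exact this.symm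

lemma klrR_mul_mem (t : {t : ℕ // t + 1 < m}) {a : KLRAlg I Λ m ν₀} (ha : a ∈ klrCoeff Λ ν₀) :
    klrR Λ ν₀ t.1 * a ∈
      (klrCoeff Λ ν₀).toSubmodule * Submodule.span (HRing I Λ) {klrR Λ ν₀ t.1}
        + (klrCoeff Λ ν₀).toSubmodule := by
  induction ha using Algebra.adjoin_induction with
  | mem a ha =>
    rcases ha with ⟨k, rfl⟩ | ⟨ν, rfl⟩
    · exact klrR_mul_klrX_mem t k
    · rw [klrR_mul_klrE]
      exact mem_klrCoeff_mul_span_add.2 ⟨_, klrE_mem _, 0, zero_mem _, add_zero _⟩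
  | algebraMap c =>
    rw [← Algebra.commutes]
    exact mem_klrCoeff_mul_span_add.2 ⟨_, algebraMap_mem _ _, 0, zero_mem _, add_zero _⟩
  | add a b _ _ ha hb =>
    rw [mul_add]
    exact add_mem ha hb
  | mul a b _ hb' ha hb =>
    obtain ⟨a₁, ha₁, a₂, ha₂, ha⟩ := mem_klrCoeff_mul_span_add.1 ha
    obtain ⟨b₁, hb₁, b₂, hb₂, hb⟩ := mem_klrCoeff_mul_span_add.1 hb
    refine mem_klrCoeff_mul_span_add.2 ⟨a₁ * b₁, mul_mem ha₁ hb₁, a₁ * b₂ + a₂ * b,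
      add_mem (mul_mem ha₁ hb₂) (mul_mem ha₂ hb'), ?_⟩
    rw [← mul_assoc, ← ha, add_mul, mul_assoc a₁ _ b, ← hb, mul_add, mul_assoc, add_assoc]

lemma klrR_mul_self_mem (t : {t : ℕ // t + 1 < m}) :
    klrR Λ ν₀ t.1 * klrR Λ ν₀ t.1 ∈
      (klrCoeff Λ ν₀).toSubmodule * Submodule.span (HRing I Λ) {klrR Λ ν₀ t.1}
        + (klrCoeff Λ ν₀).toSubmodule := by
  refine mem_of_mul_klrE fun ν => mem_klrCoeff_mul_span_add.2 ?_
  by_cases h : ν.1 (fa m t) = ν.1 (fb m t)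
  · obtain ⟨g, hg⟩ := exists_dividedDiff_Pc (Λ := Λ) (ν.1 (fa m t))
    have := klrMk_eq (KLRRel.rr_eq (Λ := Λ) t ν h g hg)
    simp only [map_mul, klrMk_gr, klrMk_ge] at this
    refine ⟨_, mul_mem (klrMk_ncEval_gv_mem t g) (klrE_mem (sAct I m ν₀ t ν)), 0, zero_mem _, ?_⟩
    rw [mul_assoc, ← klrR_mul_klrE, add_zero]
    exact this.symm
  · have := klrMk_eq (KLRRel.rr_ne (Λ := Λ) t ν h)
    simp only [map_mul, klrMk_gr, klrMk_ge] at this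
    exact ⟨0, zero_mem _, _, mul_mem (klrMk_ncEval_gv_mem t _) (klrE_mem ν),
      by rw [zero_mul, zero_add]; exact this.symm⟩

lemma klrR_braid_mem {t : ℕ} (h2 : t + 2 < m) :
    klrR Λ ν₀ (t + 1) * klrR Λ ν₀ t * klrR Λ ν₀ (t + 1) ∈
      Submodule.span (HRing I Λ) {klrR Λ ν₀ t * klrR Λ ν₀ (t + 1) * klrR Λ ν₀ t}
        + (klrCoeff Λ ν₀).toSubmodule * Submodule.span (HRing I Λ) {klrR Λ ν₀ t}
        + (klrCoeff Λ ν₀).toSubmodule * Submodule.span (HRing I Λ) {klrR Λ ν₀ (t + 1)}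
        + (klrCoeff Λ ν₀).toSubmodule := by
  suffices h : ∀ ν, ∃ c ∈
      (klrCoeff Λ ν₀).toSubmodule * Submodule.span (HRing I Λ) {klrR Λ ν₀ t}
        + (klrCoeff Λ ν₀).toSubmodule * Submodule.span (HRing I Λ) {klrR Λ ν₀ (t + 1)}
        + (klrCoeff Λ ν₀).toSubmodule,
      klrR Λ ν₀ (t + 1) * klrR Λ ν₀ t * klrR Λ ν₀ (t + 1) * klrE Λ ν =
        klrR Λ ν₀ t * klrR Λ ν₀ (t + 1) * klrR Λ ν₀ t * klrE Λ ν + c by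
    choose c hc h using h
    rw [← mul_one (klrR Λ ν₀ (t + 1) * klrR Λ ν₀ t * klrR Λ ν₀ (t + 1)), ← sum_klrE,
      Finset.mul_sum, Finset.sum_congr rfl fun ν _ => h ν, Finset.sum_add_distrib,
      ← Finset.mul_sum, sum_klrE, mul_one, add_assoc (Submodule.span _ _),
      add_assoc (Submodule.span _ _)]
    exact Submodule.add_mem_sup (Submodule.mem_span_singleton_self _)
      (Submodule.sum_mem _ fun ν _ => hc ν)
  intro ν
  have ht := klrR_mul_klrE (Λ := Λ) ⟨t, by omega⟩ ν
  have ht' := klrR_mul_klrE (Λ := Λ) ⟨t + 1, by omega⟩ ν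
  by_cases hac : ν.1 ⟨t, by omega⟩ = ν.1 ⟨t + 2, h2⟩
  · by_cases hab : ν.1 ⟨t, by omega⟩ = ν.1 ⟨t + 1, by omega⟩
    · obtain ⟨p, hp⟩ := exists_braid_coeff_left (Λ := Λ) (ν.1 ⟨t, by omega⟩)
      obtain ⟨p', hp'⟩ := exists_braid_coeff_right (Λ := Λ) (ν.1 ⟨t, by omega⟩)
      have := klrMk_eq (KLRRel.braid_P (Λ := Λ) t h2 ν hab (hab.symm.trans hac) p p' hp hp')
      simp only [map_mul, map_add, klrMk_gr, klrMk_ge] at this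
      refine ⟨_, ?_, by rw [this, add_assoc]⟩
      rw [ht, ht', ← mul_assoc, ← mul_assoc]
      refine Submodule.mem_sup_left (Submodule.add_mem_sup ?_ ?_)
      · exact Submodule.mul_mem_mul
          ((Subalgebra.mem_toSubmodule _).2 (mul_mem (klrMk_ncEval_gv3_mem t h2 p) (klrE_mem _)))
          (Submodule.mem_span_singleton_self _)
      · exact Submodule.mul_mem_mul
          ((Subalgebra.mem_toSubmodule _).2 (mul_mem (klrMk_ncEval_gv3_mem t h2 p') (klrE_mem _)))
          (Submodule.mem_span_singleton_self _)
    · obtain ⟨q, hq⟩ := exists_dividedDiff_Qc (Λ := Λ) (ν.1 ⟨t, by omega⟩) (ν.1 ⟨t + 1, by omega⟩)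
      have := klrMk_eq (KLRRel.braid_Q (Λ := Λ) t h2 ν hac hab q hq)
      simp only [map_mul (klrMk I Λ m ν₀), map_add (klrMk I Λ m ν₀), klrMk_gr, klrMk_ge] at this
      exact ⟨_, Submodule.mem_sup_right
        ((Subalgebra.mem_toSubmodule _).2
          (mul_mem (klrMk_ncEval_gv3_mem t h2 _) (klrE_mem _))), this⟩
  · have := klrMk_eq (KLRRel.braid_far (Λ := Λ) t h2 ν hac)
    simp only [map_mul, klrMk_gr, klrMk_ge] at this
    exact ⟨0, zero_mem _, by rw [this, add_zero]⟩

end Spanning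

lemma Submodule.exists_sum_eq_of_mem_sum {R M ι : Type*} [Semiring R] [AddCommMonoid M]
    [Module R M] (s : Finset ι) (p : ι → Submodule R M) {x : M} (hx : x ∈ ∑ i ∈ s, p i) :
    ∃ y : ι → M, (∀ i, y i ∈ p i) ∧ ∑ i ∈ s, y i = x := by
  classical
  induction s using Finset.induction_on generalizing x with
  | empty => exact ⟨0, fun i => zero_mem _, by simpa [eq_comm] using hx⟩
  | insert i s hi ih =>
    rw [Finset.sum_insert hi] at hx
    obtain ⟨a, ha, b, hb, rfl⟩ := Submodule.mem_sup.1 hx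
    obtain ⟨y, hy, rfl⟩ := ih hb
    refine ⟨Function.update y i a, fun j => ?_, ?_⟩
    · rcases eq_or_ne j i with rfl | h
      · simpa using ha
      · simpa [h] using hy j
    · rw [Finset.sum_insert hi, Function.update_self, Finset.sum_update_of_notMem hi]

section NormalForm

variable {I : Type} [DecidableEq I] {Λ : I → I → Type} [∀ i j, Fintype (Λ i j)] {m : ℕ}
  {ν₀ : Fin m → I}

lemma klrBraidLike : BraidLike (klrCoeff Λ ν₀).toSubmodule
    (fun t => Submodule.span (HRing I Λ) {klrR Λ ν₀ t}) where
  one_le := Submodule.one_le.2 (one_mem (klrCoeff Λ ν₀))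
  mul_self := (Subalgebra.mul_toSubmodule_le _ _).trans (by simp)
  comm t := by
    by_cases ht : t + 1 < m
    · refine Submodule.mul_le.2 fun x hx a ha => ?_
      obtain ⟨c, rfl⟩ := Submodule.mem_span_singleton.1 hx
      rw [smul_mul_assoc]
      exact Submodule.smul_mem _ _ (klrR_mul_mem ⟨t, ht⟩ ha)
    · simp [klrR_of_not_lt ht]
  sq t := by
    by_cases ht : t + 1 < m
    · rw [Submodule.span_mul_span, Set.singleton_mul_singleton, Submodule.span_singleton_le_iff_mem]
      exact klrR_mul_self_mem ⟨t, ht⟩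
    · simp [klrR_of_not_lt ht]
  far s t h := by
    simp only [Submodule.span_mul_span, Set.singleton_mul_singleton, klrR_mul_klrR_far h]
  braid t := by
    by_cases ht : t + 2 < m
    · simp only [Submodule.span_mul_span, Set.singleton_mul_singleton]
      rw [Submodule.span_singleton_le_iff_mem]
      exact klrR_braid_mem ht
    · simp [klrR_of_not_lt (show ¬ t + 1 + 1 < m from ht)]

lemma staircase_klr_eq_top :
    staircase (klrCoeff Λ ν₀).toSubmodule
      (fun t => Submodule.span (HRing I Λ) {klrR Λ ν₀ t}) m = ⊤ := by
  set N := staircase (klrCoeff Λ ν₀).toSubmodule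
    (fun t => Submodule.span (HRing I Λ) {klrR Λ ν₀ t}) m with hN
  obtain ⟨hA, hr⟩ := (klrBraidLike (Λ := Λ) (ν₀ := ν₀)).staircase_mul_le m
  have h1 : (1 : KLRAlg I Λ m ν₀) ∈ N :=
    Submodule.one_le.1 ((klrBraidLike (Λ := Λ) (ν₀ := ν₀)).one_le_staircase m)
  have hstable (a : KLRFree I Λ m ν₀) : ∀ x ∈ N, x * klrMk I Λ m ν₀ a ∈ N := by
    induction a using FreeAlgebra.induction with
    | grade0 c =>
      intro x hx
      rw [AlgHom.commutes, ← Algebra.commutes, ← Algebra.smul_def]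
      exact N.smul_mem c hx
    | grade1 g =>
      intro x hx
      cases g with
      | e ν => exact hA (Submodule.mul_mem_mul hx (klrE_mem ν))
      | x k => exact hA (Submodule.mul_mem_mul hx (klrX_mem k))
      | r t =>
        have := hr t.1 t.2 (Submodule.mul_mem_mul hx (Submodule.mem_span_singleton_self _))
        rwa [← klrMk_gr] at this
    | mul a b ha hb =>
      intro x hx
      rw [map_mul, ← mul_assoc]
      exact hb _ (ha _ hx)
    | add a b ha hb =>
      intro x hx
      rw [map_add, mul_add]
      exact N.add_mem (ha _ hx) (hb _ hx)
  refine Submodule.eq_top_iff'.2 fun b => ?_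
  obtain ⟨a, rfl⟩ := klrMk_surjective b
  simpa using hstable a 1 h1

/-- `R(α)` is spanned over its coefficient subalgebra by `m!` words in the `r_t`. -/
lemma exists_klr_normalForm (Λ : I → I → Type) [∀ i j, Fintype (Λ i j)] (ν₀ : Fin m → I) :
    ∃ (ι : Type) (_ : Fintype ι) (w : ι → List {t : ℕ // t + 1 < m}),
      Fintype.card ι = m.factorial ∧
      ∀ b : KLRAlg I Λ m ν₀, ∃ a : ι → klrCoeff Λ ν₀,
        b = ∑ i, (a i : KLRAlg I Λ m ν₀) * ((w i).map fun t => klrR Λ ν₀ t.1).prod := by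
  obtain ⟨ι, _, w, hc, hw, hs⟩ := exists_staircase_eq_sum_word
    (klrCoeff Λ ν₀).toSubmodule (fun t => Submodule.span (HRing I Λ) {klrR Λ ν₀ t}) m
  refine ⟨ι, inferInstance, fun i => (w i).attach.map fun t => ⟨t.1, hw i t.1 t.2⟩, hc,
    fun b => ?_⟩
  have hword (l : List ℕ) : (l.map fun t => Submodule.span (HRing I Λ) {klrR Λ ν₀ t}).prod =
      Submodule.span (HRing I Λ) {(l.map (klrR Λ ν₀)).prod} := by
    induction l with
    | nil => simp [Submodule.one_eq_span]
    | cons t l ih => simp [ih, Submodule.span_mul_span]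
  have hb : b ∈ staircase (klrCoeff Λ ν₀).toSubmodule
      (fun t => Submodule.span (HRing I Λ) {klrR Λ ν₀ t}) m := by
    rw [staircase_klr_eq_top]
    exact Submodule.mem_top
  simp only [hs, hword] at hb
  obtain ⟨y, hy, rfl⟩ := Submodule.exists_sum_eq_of_mem_sum _ _ hb
  have hy' (i : ι) : ∃ a : klrCoeff Λ ν₀,
      (a : KLRAlg I Λ m ν₀) * ((w i).map (klrR Λ ν₀)).prod = y i := by
    obtain ⟨a, ha, h⟩ := Submodule.mem_mul_span_singleton.1 (hy i)
    exact ⟨⟨a, ha⟩, h⟩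
  choose a ha using hy'
  refine ⟨a, Finset.sum_congr rfl fun i _ => ?_⟩
  rw [← ha, List.map_map]
  congr 2
  exact (List.attach_map_val).symm

open scoped IsMulCommutative in
variable (Λ ν₀) in
/-- Evaluation of polynomials at the elements `x_k` of `R(α)`. -/
noncomputable def klrEval : MvPolynomial (Fin m) (HRing I Λ) →ₐ[HRing I Λ] KLRAlg I Λ m ν₀ :=
  haveI : IsMulCommutative (Algebra.adjoin (HRing I Λ) (Set.range (klrX Λ ν₀))) :=
    Algebra.isMulCommutative_adjoin _ (by
      rintro _ ⟨k, rfl⟩ _ ⟨l, rfl⟩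
      exact klrX_mul_klrX k l)
  (Algebra.adjoin (HRing I Λ) (Set.range (klrX Λ ν₀))).val.comp
    (aeval fun k => ⟨klrX Λ ν₀ k, Algebra.subset_adjoin ⟨k, rfl⟩⟩)

lemma klrEval_X (k : Fin m) : klrEval Λ ν₀ (X k) = klrX Λ ν₀ k := by
  simp [klrEval]

lemma klrEval_mul_klrE (p : MvPolynomial (Fin m) (HRing I Λ)) (ν : Idx I m ν₀) :
    klrEval Λ ν₀ p * klrE Λ ν = klrE Λ ν * klrEval Λ ν₀ p := by
  induction p using MvPolynomial.induction_on with
  | C c =>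
    rw [← algebraMap_eq, AlgHom.commutes, Algebra.commutes]
  | add p q hp hq => rw [map_add, add_mul, mul_add, hp, hq]
  | mul_X p k hp => rw [map_mul, klrEval_X, mul_assoc, klrX_mul_klrE, ← mul_assoc, hp, mul_assoc]

lemma exists_eq_klrEval_mul_klrE {a : KLRAlg I Λ m ν₀} (ha : a ∈ klrCoeff Λ ν₀)
    (ν : Idx I m ν₀) : ∃ p, a * klrE Λ ν = klrEval Λ ν₀ p * klrE Λ ν := by
  induction ha using Algebra.adjoin_induction with
  | mem a ha =>
    rcases ha with ⟨k, rfl⟩ | ⟨μ, rfl⟩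
    · exact ⟨X k, by rw [klrEval_X]⟩
    · rcases eq_or_ne μ ν with rfl | h
      · exact ⟨1, by rw [map_one, one_mul, klrE_mul_self]⟩
      · exact ⟨0, by rw [map_zero, zero_mul, klrE_mul_klrE_of_ne h]⟩
  | algebraMap c => exact ⟨C c, by rw [← algebraMap_eq, AlgHom.commutes]⟩
  | add a b _ _ ha hb =>
    obtain ⟨p, hp⟩ := ha
    obtain ⟨q, hq⟩ := hb
    exact ⟨p + q, by rw [map_add, add_mul, add_mul, hp, hq]⟩
  | mul a b _ _ ha hb =>
    obtain ⟨p, hp⟩ := ha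
    obtain ⟨q, hq⟩ := hb
    exact ⟨p * q, by
      rw [map_mul, mul_assoc, hq, klrEval_mul_klrE, ← mul_assoc, hp, mul_assoc,
        ← klrEval_mul_klrE, mul_assoc]⟩

/-- The action of a word on `I^α`. -/
noncomputable def wordAct (w : List {t : ℕ // t + 1 < m}) (ν : Idx I m ν₀) : Idx I m ν₀ :=
  w.foldr (sAct I m ν₀) ν

variable (Λ ν₀) in
/-- The product of the `r_t` along a word. -/
noncomputable def klrWord (w : List {t : ℕ // t + 1 < m}) : KLRAlg I Λ m ν₀ :=
  (w.map fun t => klrR Λ ν₀ t.1).prod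

lemma klrWord_mul_klrE (w : List {t : ℕ // t + 1 < m}) (ν : Idx I m ν₀) :
    klrWord Λ ν₀ w * klrE Λ ν = klrE Λ (wordAct w ν) * klrWord Λ ν₀ w := by
  induction w with
  | nil => simp [klrWord, wordAct]
  | cons t w ih =>
    simp only [klrWord, wordAct, List.map_cons, List.prod_cons, List.foldr_cons] at ih ⊢
    rw [mul_assoc, ih, ← mul_assoc, klrR_mul_klrE, mul_assoc]

/-- Each `R(α) e(ν)` is spanned over the polynomial ring by `m!` words in the `r_t`. -/
lemma exists_klr_normalForm_mul_klrE (Λ : I → I → Type) [∀ i j, Fintype (Λ i j)]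
    (ν₀ : Fin m → I) :
    ∃ (ι : Type) (_ : Fintype ι) (w : ι → List {t : ℕ // t + 1 < m}),
      Fintype.card ι = m.factorial ∧
      ∀ (b : KLRAlg I Λ m ν₀) (ν : Idx I m ν₀),
        ∃ p : ι → MvPolynomial (Fin m) (HRing I Λ),
          b * klrE Λ ν = ∑ i, klrEval Λ ν₀ (p i) * klrWord Λ ν₀ (w i) * klrE Λ ν := by
  obtain ⟨ι, _, w, hc, h⟩ := exists_klr_normalForm Λ ν₀
  refine ⟨ι, inferInstance, w, hc, fun b ν => ?_⟩
  obtain ⟨a, rfl⟩ := h b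
  choose p hp using fun i => exists_eq_klrEval_mul_klrE (a i).2 (wordAct (w i) ν)
  refine ⟨p, ?_⟩
  rw [Finset.sum_mul]
  refine Finset.sum_congr rfl fun i _ => ?_
  change (a i : KLRAlg I Λ m ν₀) * klrWord Λ ν₀ (w i) * _ = _
  rw [mul_assoc, mul_assoc, klrWord_mul_klrE, ← mul_assoc, ← mul_assoc, hp]

end NormalForm

section PermHom

variable {I : Type} {Λ : I → I → Type} {m : ℕ}

lemma closure_swap_fa_fb (m : ℕ) :
    Submonoid.closure (Set.range fun t : {t : ℕ // t + 1 < m} => Equiv.swap (fa m t) (fb m t)) =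
      ⊤ := by
  cases m with
  | zero => exact Subsingleton.elim _ _
  | succ n =>
    rw [← Equiv.Perm.mclosure_swap_castSucc_succ]
    congr 1
    ext σ
    constructor
    · rintro ⟨t, rfl⟩
      exact ⟨⟨t.1, by have := t.2; omega⟩, rfl⟩
    · rintro ⟨i, rfl⟩
      exact ⟨⟨i.1, by omega⟩, rfl⟩

variable (Λ) in
/-- The permutation of variables by `σ`, with values in rational functions. -/
noncomputable def permHom (σ : Equiv.Perm (Fin m)) :
    MvPolynomial (Fin m) (HRing I Λ) →* KLRFrac Λ m :=
  ((algebraMap (MvPolynomial (Fin m) (HRing I Λ)) (KLRFrac Λ m)).comp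
    (rename σ : MvPolynomial (Fin m) (HRing I Λ) →ₐ[HRing I Λ] _).toRingHom).toMonoidHom

lemma permHom_apply (σ : Equiv.Perm (Fin m)) (f : MvPolynomial (Fin m) (HRing I Λ)) :
    permHom Λ σ f = permFrac σ (algebraMap _ _ f) :=
  (permFrac_algebraMap _ _).symm

lemma linearIndependent_permHom :
    LinearIndependent (KLRFrac Λ m) fun σ : Equiv.Perm (Fin m) => ⇑(permHom Λ σ) := by
  refine (linearIndependent_monoidHom _ _).comp (permHom Λ) fun σ τ h => ?_
  ext k : 1
  have := DFunLike.congr_fun h (X k)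
  simp only [permHom_apply, permFrac_fracX] at this
  exact fracX_injective this

end PermHom

section Faithful

variable {I : Type} [DecidableEq I] {Λ : I → I → Type} [∀ i j, Fintype (Λ i j)] {m : ℕ}
  {ν₀ : Fin m → I}

variable (Λ ν₀) in
/-- The polynomial representation of `R(α)`. -/
noncomputable def klrRep :
    KLRAlg I Λ m ν₀ →ₐ[HRing I Λ] Module.End (HRing I Λ) (KLRPol Λ ν₀) :=
  RingQuot.liftAlgHom (HRing I Λ) ⟨freeRep Λ ν₀, fun _ _ h => freeRep_rel h⟩

lemma klrRep_klrMk (a : KLRFree I Λ m ν₀) :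
    klrRep Λ ν₀ (klrMk I Λ m ν₀ a) = freeRep Λ ν₀ a :=
  RingQuot.liftAlgHom_mkAlgHom_apply _ _ _ _

lemma klrRep_klrE (ν : Idx I m ν₀) : klrRep Λ ν₀ (klrE Λ ν) = opE Λ ν := by
  rw [klrE, klrRep_klrMk, freeRep_ge]

lemma klrRep_klrR (t : {t : ℕ // t + 1 < m}) : klrRep Λ ν₀ (klrR Λ ν₀ t.1) = opR Λ ν₀ t := by
  rw [← klrMk_gr, klrRep_klrMk, freeRep_gr]

lemma klrRep_klrEval (p : MvPolynomial (Fin m) (HRing I Λ)) :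
    klrRep Λ ν₀ (klrEval Λ ν₀ p) = opMul Λ ν₀ p := by
  have : (klrRep Λ ν₀).comp (klrEval Λ ν₀) = opMul Λ ν₀ := by
    refine MvPolynomial.algHom_ext fun k => ?_
    rw [AlgHom.comp_apply, klrEval_X, klrX, klrRep_klrMk, freeRep_gx]
  exact DFunLike.congr_fun this p

variable (Λ) in
/-- The operator on polynomials through which the word `w` maps the `ν`-component of `Pol(α)` to
the `wν`-component. -/
noncomputable def wordOp (ν : Idx I m ν₀) : List {t : ℕ // t + 1 < m} →
    MvPolynomial (Fin m) (HRing I Λ) → MvPolynomial (Fin m) (HRing I Λ)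
  | [], f => f
  | t :: w, f => polIntertwiner Λ ν₀ t ((wordAct w ν).1 (fa m t)) ((wordAct w ν).1 (fb m t))
      (wordOp ν w f)

lemma klrRep_klrWord_single (w : List {t : ℕ // t + 1 < m}) (ν : Idx I m ν₀)
    (f : MvPolynomial (Fin m) (HRing I Λ)) :
    klrRep Λ ν₀ (klrWord Λ ν₀ w) (Pi.single ν f) =
      Pi.single (wordAct w ν) (wordOp Λ ν w f) := by
  induction w with
  | nil => simp [klrWord, wordAct, wordOp]
  | cons t w ih =>
    have : klrWord Λ ν₀ (t :: w) = klrR Λ ν₀ t.1 * klrWord Λ ν₀ w := by simp [klrWord]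
    rw [this, map_mul, Module.End.mul_apply, ih, klrRep_klrR, opR_single]
    rfl

lemma klrRep_sum_single {ι : Type} [Fintype ι] (w : ι → List {t : ℕ // t + 1 < m})
    (p : ι → MvPolynomial (Fin m) (HRing I Λ)) (ν : Idx I m ν₀)
    (f : MvPolynomial (Fin m) (HRing I Λ)) :
    ∑ μ, klrRep Λ ν₀ (∑ i, klrEval Λ ν₀ (p i) * klrWord Λ ν₀ (w i) * klrE Λ ν)
      (Pi.single ν f) μ = ∑ i, p i * wordOp Λ ν (w i) f := by
  simp only [map_sum, map_mul, LinearMap.sum_apply, Module.End.mul_apply, klrRep_klrE,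
    opE_single_self, klrRep_klrWord_single, klrRep_klrEval, opMul_single, Finset.sum_apply]
  rw [Finset.sum_comm]
  exact Finset.sum_congr rfl fun i _ => Fintype.sum_pi_single' _ _

variable (Λ) in
/-- The action of a word on a component of `Pol(α)`, with values in rational functions. -/
noncomputable def fracWord (ν : Idx I m ν₀) (w : List {t : ℕ // t + 1 < m}) :
    MvPolynomial (Fin m) (HRing I Λ) → KLRFrac Λ m :=
  fun f => algebraMap _ _ (wordOp Λ ν w f)

lemma fracWord_cons (ν : Idx I m ν₀) (t : {t : ℕ // t + 1 < m})
    (w : List {t : ℕ // t + 1 < m}) (f : MvPolynomial (Fin m) (HRing I Λ)) :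
    fracWord Λ ν (t :: w) f = fracIntertwiner t ((wordAct w ν).1 (fa m t))
      ((wordAct w ν).1 (fb m t)) (fracWord Λ ν w f) :=
  algebraMap_polIntertwiner _ _ _ _

lemma permFrac_comp_fracWord_mem (ν : Idx I m ν₀) (t : {t : ℕ // t + 1 < m})
    (w : List {t : ℕ // t + 1 < m}) :
    (fun f => permFrac (Equiv.swap (fa m t) (fb m t)) (fracWord Λ ν w f)) ∈
      Submodule.span (KLRFrac Λ m) (Set.range (fracWord Λ ν)) := by
  have hc (i j : I) : fracCoeff Λ m i j (fracX Λ m (fa m t) - fracX Λ m (fb m t)) ≠ 0 := by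
    rw [fracCoeff_fracX_sub (ν₀ := ν₀)]
    exact (FaithfulSMul.algebraMap_injective _ _).ne_iff' (map_zero _) |>.2
      (polCoeff_ne_zero _ _ _)
  have hx := sub_ne_zero.2 (fracX_ne (Λ := Λ) (fa_ne_fb t))
  have hmem (v : List {t : ℕ // t + 1 < m}) : fracWord Λ ν v ∈
      Submodule.span (KLRFrac Λ m) (Set.range (fracWord Λ ν)) :=
    Submodule.subset_span ⟨v, rfl⟩
  set i := (wordAct w ν).1 (fa m t) with hi
  set j := (wordAct w ν).1 (fb m t) with hj
  by_cases h : i = j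
  · convert Submodule.add_mem _ (Submodule.smul_mem _
      ((fracCoeff Λ m i i (fracX Λ m (fa m t) - fracX Λ m (fb m t)))⁻¹ *
        (fracX Λ m (fa m t) - fracX Λ m (fb m t))) (hmem (t :: w))) (hmem w) using 1
    ext f
    have := hc i i
    rw [Pi.add_apply, Pi.smul_apply, smul_eq_mul, fracWord_cons, ← hi, ← hj, ← h, fracIntertwiner,
      intertwiner_self]
    field_simp
    ring
  · convert Submodule.smul_mem _
      (fracCoeff Λ m i j (fracX Λ m (fa m t) - fracX Λ m (fb m t)))⁻¹ (hmem (t :: w)) using 1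
    ext f
    rw [Pi.smul_apply, smul_eq_mul, fracWord_cons, ← hi, ← hj, fracIntertwiner,
      intertwiner_of_ne h, inv_mul_cancel_left₀ (hc i j)]

lemma permFrac_comp_mem {ν : Idx I m ν₀} (t : {t : ℕ // t + 1 < m})
    {F : MvPolynomial (Fin m) (HRing I Λ) → KLRFrac Λ m}
    (hF : F ∈ Submodule.span (KLRFrac Λ m) (Set.range (fracWord Λ ν))) :
    (fun f => permFrac (Equiv.swap (fa m t) (fb m t)) (F f)) ∈
      Submodule.span (KLRFrac Λ m) (Set.range (fracWord Λ ν)) := by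
  induction hF using Submodule.span_induction with
  | mem F hF =>
    obtain ⟨w, rfl⟩ := hF
    exact permFrac_comp_fracWord_mem ν t w
  | zero =>
    convert Submodule.zero_mem
      (Submodule.span (KLRFrac Λ m) (Set.range (fracWord Λ ν))) using 1
    ext f
    simp
  | add F G _ _ hF hG =>
    convert Submodule.add_mem _ hF hG using 1
    ext f
    simp
  | smul c F _ hF =>
    convert Submodule.smul_mem _ (permFrac (Equiv.swap (fa m t) (fb m t)) c) hF using 1
    ext f
    simp

lemma permHom_mem (ν : Idx I m ν₀) (σ : Equiv.Perm (Fin m)) :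
    ⇑(permHom Λ σ) ∈ Submodule.span (KLRFrac Λ m) (Set.range (fracWord Λ ν)) := by
  have hσ : σ ∈ Submonoid.closure
      (Set.range fun t : {t : ℕ // t + 1 < m} => Equiv.swap (fa m t) (fb m t)) := by
    rw [closure_swap_fa_fb]
    trivial
  induction hσ using Submonoid.closure_induction_left with
  | one =>
    have h : ⇑(permHom Λ 1) = fracWord Λ ν [] := by
      ext f
      rw [permHom_apply, permFrac_one]
      rfl
    rw [h]
    exact Submodule.subset_span ⟨[], rfl⟩
  | mul_left s hs τ _ ih =>
    obtain ⟨t, rfl⟩ := hs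
    convert permFrac_comp_mem t ih using 1
    ext f
    rw [permHom_apply, permHom_apply, permFrac_permFrac]

/-- The normal form words act on `Pol(α)` linearly independently over the rational functions. -/
lemma linearIndependent_fracWord {ι : Type} [Fintype ι] {w : ι → List {t : ℕ // t + 1 < m}}
    (hc : Fintype.card ι = m.factorial)
    (hw : ∀ (b : KLRAlg I Λ m ν₀) (ν : Idx I m ν₀),
        ∃ p : ι → MvPolynomial (Fin m) (HRing I Λ),
          b * klrE Λ ν = ∑ i, klrEval Λ ν₀ (p i) * klrWord Λ ν₀ (w i) * klrE Λ ν)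
    (ν : Idx I m ν₀) :
    LinearIndependent (KLRFrac Λ m) fun i => fracWord Λ ν (w i) := by
  have hle : Submodule.span (KLRFrac Λ m) (Set.range (fracWord Λ ν)) ≤
      Submodule.span (KLRFrac Λ m) (Set.range fun i => fracWord Λ ν (w i)) := by
    rw [Submodule.span_le]
    rintro _ ⟨v, rfl⟩
    obtain ⟨p, hp⟩ := hw (klrWord Λ ν₀ v) ν
    have : fracWord Λ ν v =
        ∑ i, algebraMap _ (KLRFrac Λ m) (p i) • fracWord Λ ν (w i) := by
      ext f
      have h := klrRep_sum_single w p ν f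
      rw [← hp, map_mul, Module.End.mul_apply, klrRep_klrE, opE_single_self,
        klrRep_klrWord_single, Fintype.sum_pi_single'] at h
      simp only [fracWord, h, map_sum, map_mul, Finset.sum_apply, Pi.smul_apply, smul_eq_mul]
    rw [this]
    exact Submodule.sum_mem _ fun i _ => Submodule.smul_mem _ _ (Submodule.subset_span ⟨i, rfl⟩)
  have hcard : Fintype.card ι = Fintype.card (Equiv.Perm (Fin m)) := by
    rw [hc, Fintype.card_perm, Fintype.card_fin]
  rw [linearIndependent_iff_card_le_finrank_span, hcard, Set.finrank,
    ← finrank_span_eq_card (linearIndependent_permHom (Λ := Λ))]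
  have : Module.Finite (KLRFrac Λ m)
      (Submodule.span (KLRFrac Λ m) (Set.range fun i => fracWord Λ ν (w i))) :=
    Module.Finite.span_of_finite _ (Set.finite_range _)
  refine Submodule.finrank_mono ?_
  rw [Submodule.span_le]
  rintro _ ⟨σ, rfl⟩
  exact hle (permHom_mem ν σ)

lemma eq_zero_of_klrRep_eq_zero {b : KLRAlg I Λ m ν₀} (hb : klrRep Λ ν₀ b = 0) : b = 0 := by
  obtain ⟨ι, _, w, hc, hw⟩ := exists_klr_normalForm_mul_klrE Λ ν₀
  rw [← Submodule.mem_bot (HRing I Λ)]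
  refine mem_of_mul_klrE fun ν => ?_
  obtain ⟨p, hp⟩ := hw b ν
  have hlin := Fintype.linearIndependent_iff.1 (linearIndependent_fracWord hc hw ν)
    (fun i => algebraMap _ _ (p i)) (by
      ext f
      have h := klrRep_sum_single w p ν f
      rw [← hp, map_mul, hb, zero_mul] at h
      simp only [LinearMap.zero_apply, Pi.zero_apply, Finset.sum_const_zero] at h
      simp only [fracWord, Finset.sum_apply, Pi.smul_apply, smul_eq_mul, ← map_mul, ← map_sum,
        ← h, map_zero, Pi.zero_apply])
  have hp0 (i : ι) : p i = 0 :=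
    FaithfulSMul.algebraMap_injective _ (KLRFrac Λ m) ((hlin i).trans (map_zero _).symm)
  simp [hp, hp0]

lemma klrRep_injective : Function.Injective (klrRep Λ ν₀) := by
  intro a b hab
  have hneg (c : KLRAlg I Λ m ν₀) : c + algebraMap (HRing I Λ) _ (-1) * c = 0 := by
    nth_rewrite 1 [← one_mul c]
    rw [← map_one (algebraMap (HRing I Λ) _), ← add_mul, ← map_add, add_neg_cancel, map_zero,
      zero_mul]
  have h : a + algebraMap (HRing I Λ) _ (-1) * b = 0 :=
    eq_zero_of_klrRep_eq_zero (by rw [map_add, hab, map_mul, ← map_mul, ← map_add, hneg, map_zero])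
  calc a = a + (b + algebraMap (HRing I Λ) _ (-1) * b) := by rw [hneg, add_zero]
    _ = b := by rw [add_left_comm, h, add_zero]

end Faithful

/-- The given formulas define a faithful `R(α)`-module structure on
`Pol(α) = ⊕_{ν ∈ I^α} ℍ[x_1,…,x_m]`: there is an (injective) algebra homomorphism
`ρ : R(α) → End_ℍ(Pol(α))` acting on the `ν`-component `Pi.single ν f` by the given
formulas (the divided difference `∂_l f` being encoded by its defining identity). -/
theorem stmt16 (I : Type) [DecidableEq I] (Λ : I → I → Type) [∀ i j, Fintype (Λ i j)]
    (m : ℕ) (ν₀ : Fin m → I) :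
    ∃ ρ : KLRAlg I Λ m ν₀ →ₐ[HRing I Λ]
        Module.End (HRing I Λ) (Idx I m ν₀ → MvPolynomial (Fin m) (HRing I Λ)),
      Function.Injective ρ ∧
      (∀ (ν ν' : Idx I m ν₀) (f : MvPolynomial (Fin m) (HRing I Λ)),
        ρ (klrMk I Λ m ν₀ (ge I Λ m ν₀ ν)) (Pi.single ν' f) =
          if ν' = ν then Pi.single ν' f else 0) ∧
      (∀ (k : Fin m) (ν : Idx I m ν₀) (f : MvPolynomial (Fin m) (HRing I Λ)),
        ρ (klrMk I Λ m ν₀ (gx I Λ m ν₀ k)) (Pi.single ν f) = Pi.single ν (X k * f)) ∧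
      (∀ (t : {t : ℕ // t + 1 < m}) (ν : Idx I m ν₀)
          (f : MvPolynomial (Fin m) (HRing I Λ)), sAct I m ν₀ t ν ≠ ν →
        ρ (klrMk I Λ m ν₀ (gr I Λ m ν₀ t)) (Pi.single ν f) =
          Pi.single (sAct I m ν₀ t ν)
            (polCoeff I Λ m ν₀ (ν.1 (fa m t)) (ν.1 (fb m t)) t *
              rename (⇑(Equiv.swap (fa m t) (fb m t))) f)) ∧
      (∀ (t : {t : ℕ // t + 1 < m}) (ν : Idx I m ν₀)
          (f g : MvPolynomial (Fin m) (HRing I Λ)), sAct I m ν₀ t ν = ν →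
        (X (fa m t) - X (fb m t)) * g = rename (⇑(Equiv.swap (fa m t) (fb m t))) f - f →
        ρ (klrMk I Λ m ν₀ (gr I Λ m ν₀ t)) (Pi.single ν f) =
          Pi.single ν (polCoeff I Λ m ν₀ (ν.1 (fa m t)) (ν.1 (fa m t)) t * g)) := by
  refine ⟨klrRep Λ ν₀, klrRep_injective, fun ν μ f => ?_, fun k ν f => ?_,
    fun t ν f h => ?_, fun t ν f g h hg => ?_⟩
  · rw [klrRep_klrMk, freeRep_ge]
    split_ifs with h
    · rw [← h, opE_single_self]
    · exact opE_single_of_ne (Ne.symm h) f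
  · rw [klrRep_klrMk, freeRep_gx, opMul_single]
  · rw [klrRep_klrMk, freeRep_gr, opR_single, polIntertwiner,
      if_neg ((sAct_eq_self_iff t ν).not.1 h)]
    rfl
  · have h' := (sAct_eq_self_iff t ν).1 h
    rw [klrRep_klrMk, freeRep_gr, opR_single, h, polIntertwiner, ← h', if_pos rfl,
      ← X_sub_X_mul_dividedDiff (fa_ne_fb t)] at *
    rw [mul_left_cancel₀ (X_sub_X_ne_zero (fa_ne_fb t)) hg]
    rfl
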